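/- Under hypotheses (H1), (H2) and (H3), if η is a g-invariant Borel probability measure which is singular with respect to the accumulation point ν of (ν_n), then h_η(g) < h_top(g). -/

import Mathlib

open MeasureTheory Filter Topology Set
open scoped ENNReal NNReal

namespace Samva

variable {X : Type*}

/-- The `n`-th iterate (`n : ℤ`) of a homeomorphism. -/
noncomputable def zIter [TopologicalSpace X] (f : X ≃ₜ X) : ℤ → X → X
  | Int.ofNat n => (f : X → X)^[n]
  | Int.negSucc n => (f.symm : X → X)^[n + 1]

/-- `f` is expansive with expansivity constant `α`. -/
def IsExpansiveWith [PseudoMetricSpace X] (f : X ≃ₜ X) (α : ℝ) : Prop :=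
  0 < α ∧ ∀ x y : X, (∀ n : ℤ, dist (zIter f n x) (zIter f n y) ≤ α) → x = y

/-- `f` is expansive. -/
def IsExpansive [PseudoMetricSpace X] (f : X ≃ₜ X) : Prop :=
  ∃ α : ℝ, IsExpansiveWith f α

/-- The (periodic) specification property. -/
def HasSpecification [PseudoMetricSpace X] (f : X ≃ₜ X) : Prop :=
  ∀ ε : ℝ, 0 < ε → ∃ M : ℕ, ∀ (k : ℕ) (x : Fin (k + 1) → X) (a b : Fin (k + 1) → ℤ),
    (∀ i, a i ≤ b i) →
    (∀ i : Fin k, (M : ℤ) ≤ a i.succ - b i.castSucc) →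
    ∀ p : ℤ, (M : ℤ) + b (Fin.last k) - a 0 ≤ p →
      ∃ z : X, zIter f p z = z ∧
        ∀ i, ∀ j : ℤ, a i ≤ j → j ≤ b i → dist (zIter f j z) (zIter f j (x i)) ≤ ε

/-- The set of `n`-periodic points. -/
def perSet (f : X → X) (n : ℕ) : Set X := {x | f^[n] x = x}

/-- The uniform (equidistributed) probability measure on the `n`-periodic points of `f`,
`μ_n = |Per_n(f)|⁻¹ ∑_{x ∈ Per_n(f)} δ_x`. -/
noncomputable def perMeasure [MeasurableSpace X] (f : X → X) (n : ℕ) : Measure X :=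
  ProbabilityTheory.uniformOn (perSet f n)

/-- The uniform probability measure on a set `s`,
`|s|⁻¹ ∑_{x ∈ s} δ_x`. -/
noncomputable def unifMeasure [MeasurableSpace X] (s : Set X) : Measure X :=
  ProbabilityTheory.uniformOn s

/-- Weak* convergence of a sequence of measures against continuous test functions. -/
def WeakLimit [TopologicalSpace X] [MeasurableSpace X] (μs : ℕ → Measure X) (ν : Measure X) :
    Prop :=
  ∀ φ : C(X, ℝ), Tendsto (fun n => ∫ x, φ x ∂(μs n)) atTop (𝓝 (∫ x, φ x ∂ν))

/-- `ν` is a weak* accumulation point of the sequence `μs`. -/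
def WeakClusterPt [TopologicalSpace X] [MeasurableSpace X] (μs : ℕ → Measure X)
    (ν : Measure X) : Prop :=
  ∃ u : ℕ → ℕ, StrictMono u ∧ WeakLimit (μs ∘ u) ν

/-- `E` is `(n,ε)`-separated for `g`. -/
def IsSep [PseudoMetricSpace X] (g : X → X) (n : ℕ) (ε : ℝ) (E : Set X) : Prop :=
  E.Pairwise fun x y => ∃ j < n, ε < dist (g^[j] x) (g^[j] y)

/-- Maximal cardinality of an `(n,ε)`-separated subset of `K` for `g`. -/
noncomputable def sepCard [PseudoMetricSpace X] (g : X → X) (K : Set X) (n : ℕ) (ε : ℝ) :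
    ℝ≥0∞ :=
  ⨆ (E : Finset X) (_ : ↑E ⊆ K ∧ IsSep g n ε ↑E), (E.card : ℝ≥0∞)

/-- Topological entropy of `g` relative to the set `K`:
`h_top(g,K) = lim_{ε→0} limsup_n (1/n) log E_K(n,ε)`; since the inner quantity is
monotone in `ε`, the limit as `ε → 0` is the supremum over `ε > 0`. -/
noncomputable def relEntropy [PseudoMetricSpace X] (g : X → X) (K : Set X) : EReal :=
  ⨆ (ε : ℝ) (_ : 0 < ε),
    Filter.limsup (fun n : ℕ => ENNReal.log (sepCard g K n ε) / (n : EReal)) atTop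

/-- Topological entropy of `g`. -/
noncomputable def topEntropy [PseudoMetricSpace X] (g : X → X) : EReal :=
  relEntropy g Set.univ

/-- A finite measurable partition of `X`. -/
def IsMPartition [MeasurableSpace X] (P : Finset (Set X)) : Prop :=
  (∀ A ∈ P, MeasurableSet A) ∧ ((P : Set (Set X)).PairwiseDisjoint id) ∧
    ⋃₀ (P : Set (Set X)) = Set.univ

/-- The entropy `H_μ(P ∨ g⁻¹P ∨ ⋯ ∨ g^{-(n-1)}P)` of the `n`-th dynamical refinement of the
partition `P`. -/
noncomputable def dynH [MeasurableSpace X] (μ : Measure X) (g : X → X) (P : Finset (Set X))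
    (n : ℕ) : ℝ :=
  ∑ A : Fin n → ↥P, Real.negMulLog (μ (⋂ i : Fin n, g^[i.1] ⁻¹' ((A i : Set X)))).toReal

/-- The measure-theoretic (Kolmogorov–Sinai) entropy `h_μ(g)`, using that for invariant `μ`
the limit `lim_n H_n/n` equals `inf_n H_n/n` by subadditivity. -/
noncomputable def mEntropy [MeasurableSpace X] (g : X → X) (μ : Measure X) : EReal :=
  ⨆ P : {P : Finset (Set X) // IsMPartition P},
    ⨅ n : ℕ, ((dynH μ g (P : Finset (Set X)) (n + 1) / (n + 1) : ℝ) : EReal)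

section Hyp

variable [MetricSpace X] [CompactSpace X] [MeasurableSpace X] [BorelSpace X]

/-- Hypothesis (H1): every class `[x] = h⁻¹(h x)` has zero relative topological entropy. -/
def HypH1 (g h : X → X) : Prop :=
  ∀ x : X, relEntropy g (h ⁻¹' {h x}) = 0

/-- Hypothesis (H2): every periodic class contains a `g`-periodic point whose `g`-period is
the `f`-period of `h x`. -/
def HypH2 (f g h : X → X) : Prop :=
  ∀ x : X, h x ∈ Function.periodicPts f →
    ∃ y : X, h y = h x ∧ Function.minimalPeriod g y = Function.minimalPeriod f (h x)

/-- Hypothesis (H3): the set of points whose class is trivial has full Bowen measure. -/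
def HypH3 (h : X → X) (μ : Measure X) : Prop :=
  μ {y : X | ∃ x : X, h ⁻¹' {y} = {x}} = 1

/-- `P` is an admissible choice of the sets `P̃er_n(g)`: `P n` consists of `g`-periodic points
of period `n` lying over `Per_n(f)`, and `h` maps `P n` bijectively onto `Per_n(f)`. -/
def IsPerSelection (f g h : X → X) (P : ℕ → Set X) : Prop :=
  ∀ n : ℕ, P n ⊆ perSet g n ∧ (∀ x ∈ P n, g x ∈ P n) ∧ Set.BijOn h (P n) (perSet f n)

end Hyp

end Samva

open Samva

namespace SamvaAux

section Entropy

variable {X : Type*} [MeasurableSpace X]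

/-- The fibres of `φ` are measurable. -/
def MF {ι : Type*} (φ : X → ι) : Prop := ∀ i, MeasurableSet (φ ⁻¹' {i})

/-- The distribution of `φ`. -/
noncomputable def pr {ι : Type*} (m : Measure X) (φ : X → ι) (i : ι) : ℝ := m.real (φ ⁻¹' {i})

/-- The Shannon entropy of `φ`. -/
noncomputable def Hf {ι : Type*} [Fintype ι] (m : Measure X) (φ : X → ι) : ℝ :=
  ∑ i, Real.negMulLog (pr m φ i)

lemma pr_nonneg {ι : Type*} (m : Measure X) (φ : X → ι) (i : ι) : 0 ≤ pr m φ i :=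
  measureReal_nonneg

open Classical in
lemma MF.comp {ι κ : Type*} [Fintype ι] {φ : X → ι} (hφ : MF φ) (F : ι → κ) :
    MF (fun x => F (φ x)) := by
  intro k
  have : (fun x => F (φ x)) ⁻¹' {k} = ⋃ i ∈ Finset.univ.filter (fun i => F i = k), φ ⁻¹' {i} := by
    ext x; simp
  rw [this]
  exact Finset.measurableSet_biUnion _ fun i _ => hφ i

open Classical in
lemma pr_comp {ι κ : Type*} [Fintype ι] (m : Measure X) [IsFiniteMeasure m]
    {φ : X → ι} (hφ : MF φ) (F : ι → κ) (k : κ) :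
    pr m (fun x => F (φ x)) k = ∑ i ∈ Finset.univ.filter (fun i => F i = k), pr m φ i := by
  have : (fun x => F (φ x)) ⁻¹' {k} = ⋃ i ∈ Finset.univ.filter (fun i => F i = k), φ ⁻¹' {i} := by
    ext x; simp
  unfold pr
  rw [this, measureReal_biUnion_finset]
  · intro i _ j _ hij
    refine Set.disjoint_left.2 fun x hx hy => hij ?_
    simp only [mem_preimage, mem_singleton_iff] at hx hy
    rw [← hx, ← hy]
  · exact fun i _ => hφ i

open Classical in
lemma sum_pr_comp {ι κ : Type*} [Fintype ι] [Fintype κ] (m : Measure X) [IsFiniteMeasure m]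
    {φ : X → ι} (hφ : MF φ) (F : ι → κ) (u : κ → ℝ) :
    ∑ k, pr m (fun x => F (φ x)) k * u k = ∑ i, pr m φ i * u (F i) := by
  rw [← Finset.sum_fiberwise Finset.univ F]
  refine Finset.sum_congr rfl fun k _ => ?_
  rw [pr_comp m hφ, Finset.sum_mul]
  refine Finset.sum_congr rfl fun i hi => ?_
  rw [(Finset.mem_filter.1 hi).2]

lemma sum_pr {ι : Type*} [Fintype ι] (m : Measure X) [IsProbabilityMeasure m]
    {φ : X → ι} (hφ : MF φ) : ∑ i, pr m φ i = 1 := by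
  have := sum_pr_comp m hφ (fun _ => ()) (fun _ => 1)
  simp only [mul_one] at this
  rw [← this]
  simp [pr]

lemma pr_le_comp {ι κ : Type*} (m : Measure X) [IsFiniteMeasure m]
    (φ : X → ι) (F : ι → κ) (i : ι) :
    pr m φ i ≤ pr m (fun x => F (φ x)) (F i) := by
  refine measureReal_mono ?_
  intro x hx
  simp only [mem_preimage, mem_singleton_iff] at hx ⊢
  rw [hx]

lemma gibbs {ι : Type*} [Fintype ι] (m : Measure X) [IsProbabilityMeasure m]
    {φ : X → ι} (hφ : MF φ) (q : ι → ℝ) (hq0 : ∀ i, 0 ≤ q i)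
    (hq : ∀ i, 0 < pr m φ i → 0 < q i) (hs : ∑ i, q i ≤ 1) :
    Hf m φ ≤ ∑ i, pr m φ i * (- Real.log (q i)) := by
  have key : ∀ i, Real.negMulLog (pr m φ i) - pr m φ i * (- Real.log (q i)) ≤ q i - pr m φ i := by
    intro i
    rcases (pr_nonneg m φ i).eq_or_lt with h0 | h0
    · rw [← h0]; simpa using hq0 i
    · have h1 := hq i h0
      have h2 := Real.log_le_sub_one_of_pos (div_pos h1 h0)
      rw [Real.log_div h1.ne' h0.ne'] at h2
      have h3 := mul_le_mul_of_nonneg_left h2 h0.le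
      have h4 : pr m φ i * (q i / pr m φ i - 1) = q i - pr m φ i := by field_simp
      rw [h4] at h3
      unfold Real.negMulLog
      linarith
  have := Finset.sum_le_sum fun i (_ : i ∈ Finset.univ) => key i
  rw [Finset.sum_sub_distrib, Finset.sum_sub_distrib, sum_pr m hφ] at this
  unfold Hf
  linarith

lemma Hf_comp_le {ι κ : Type*} [Fintype ι] [Fintype κ] (m : Measure X) [IsProbabilityMeasure m]
    {φ : X → ι} (hφ : MF φ) (F : ι → κ) : Hf m (fun x => F (φ x)) ≤ Hf m φ := by
  have h1 : Hf m (fun x => F (φ x)) =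
      ∑ i, pr m φ i * (- Real.log (pr m (fun x => F (φ x)) (F i))) := by
    rw [← sum_pr_comp m hφ F (fun k => - Real.log (pr m (fun x => F (φ x)) k))]
    unfold Hf Real.negMulLog
    exact Finset.sum_congr rfl fun i _ => by ring
  rw [h1]
  unfold Hf Real.negMulLog
  refine Finset.sum_le_sum fun i _ => ?_
  rcases (pr_nonneg m φ i).eq_or_lt with h0 | h0
  · rw [← h0]; simp
  · have := Real.log_le_log h0 (pr_le_comp m φ F i)
    nlinarith

lemma MF.pi {J : Type*} [Fintype J] {ι : J → Type*} {φ : ∀ j, X → ι j}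
    (hφ : ∀ j, MF (φ j)) : MF (fun x j => φ j x) := by
  intro A
  have : (fun x j => φ j x) ⁻¹' {A} = ⋂ j, φ j ⁻¹' {A j} := by
    ext x; simp [funext_iff]
  rw [this]
  exact MeasurableSet.iInter fun j => hφ j (A j)

lemma Hf_pi_le {J : Type*} [Fintype J] [DecidableEq J] {ι : J → Type*} [∀ j, Fintype (ι j)]
    (m : Measure X) [IsProbabilityMeasure m] {φ : ∀ j, X → ι j}
    (hφ : ∀ j, MF (φ j)) : Hf m (fun x j => φ j x) ≤ ∑ j, Hf m (φ j) := by
  have hpi := MF.pi hφ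
  have hpos : ∀ A : ∀ j, ι j, 0 < pr m (fun x j => φ j x) A → ∀ j, 0 < pr m (φ j) (A j) := by
    intro A hA j
    exact hA.trans_le (pr_le_comp m (fun x j => φ j x) (fun A => A j) A)
  refine (gibbs m hpi (fun A => ∏ j, pr m (φ j) (A j))
    (fun A => Finset.prod_nonneg fun j _ => pr_nonneg _ _ _)
    (fun A hA => Finset.prod_pos fun j _ => hpos A hA j) ?_).trans_eq ?_
  · rw [← Fintype.prod_sum]
    simp [sum_pr m (hφ _)]
  · have h1 : ∀ j, Hf m (φ j) =
        ∑ A, pr m (fun x j => φ j x) A * (- Real.log (pr m (φ j) (A j))) := by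
      intro j
      rw [← sum_pr_comp m hpi (fun A => A j) (fun k => - Real.log (pr m (φ j) k))]
      unfold Hf Real.negMulLog
      exact Finset.sum_congr rfl fun i _ => by ring
    simp_rw [h1]
    rw [Finset.sum_comm]
    refine Finset.sum_congr rfl fun A _ => ?_
    rw [← Finset.mul_sum, Finset.sum_neg_distrib]
    rcases (pr_nonneg m (fun x j => φ j x) A).eq_or_lt with h0 | h0
    · rw [← h0]; simp
    · rw [Real.log_prod fun j _ => (hpos A h0 j).ne']

lemma MF.prodMk {ι κ : Type*} {φ : X → ι} {ψ : X → κ}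
    (hφ : MF φ) (hψ : MF ψ) : MF (fun x => (φ x, ψ x)) := by
  rintro ⟨a, b⟩
  have : (fun x => (φ x, ψ x)) ⁻¹' {(a, b)} = φ ⁻¹' {a} ∩ ψ ⁻¹' {b} := by
    ext x; simp
  rw [this]
  exact (hφ a).inter (hψ b)

lemma Hf_pair_le {ι κ : Type*} [Fintype ι] [Fintype κ] (m : Measure X) [IsProbabilityMeasure m]
    {φ : X → ι} {ψ : X → κ} (hφ : MF φ) (hψ : MF ψ) :
    Hf m (fun x => (φ x, ψ x)) ≤ Hf m φ + Hf m ψ := by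
  have hpi := hφ.prodMk hψ
  have hpos1 : ∀ A : ι × κ, 0 < pr m (fun x => (φ x, ψ x)) A → 0 < pr m φ A.1 := by
    intro A hA
    exact hA.trans_le (pr_le_comp m (fun x => (φ x, ψ x)) Prod.fst A)
  have hpos2 : ∀ A : ι × κ, 0 < pr m (fun x => (φ x, ψ x)) A → 0 < pr m ψ A.2 := by
    intro A hA
    exact hA.trans_le (pr_le_comp m (fun x => (φ x, ψ x)) Prod.snd A)
  refine (gibbs m hpi (fun A => pr m φ A.1 * pr m ψ A.2)
    (fun A => mul_nonneg (pr_nonneg _ _ _) (pr_nonneg _ _ _))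
    (fun A hA => mul_pos (hpos1 A hA) (hpos2 A hA)) ?_).trans_eq ?_
  · rw [Fintype.sum_prod_type]
    simp [← Finset.mul_sum, sum_pr m hψ, sum_pr m hφ]
  · have h1 : Hf m φ =
        ∑ A, pr m (fun x => (φ x, ψ x)) A * (- Real.log (pr m φ A.1)) := by
      rw [← sum_pr_comp m hpi Prod.fst (fun k => - Real.log (pr m φ k))]
      unfold Hf Real.negMulLog
      exact Finset.sum_congr rfl fun i _ => by ring
    have h2 : Hf m ψ =
        ∑ A, pr m (fun x => (φ x, ψ x)) A * (- Real.log (pr m ψ A.2)) := by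
      rw [← sum_pr_comp m hpi Prod.snd (fun k => - Real.log (pr m ψ k))]
      unfold Hf Real.negMulLog
      exact Finset.sum_congr rfl fun i _ => by ring
    rw [h1, h2, ← Finset.sum_add_distrib]
    refine Finset.sum_congr rfl fun A _ => ?_
    rcases (pr_nonneg m (fun x => (φ x, ψ x)) A).eq_or_lt with h0 | h0
    · rw [← h0]; simp
    · rw [Real.log_mul (hpos1 A h0).ne' (hpos2 A h0).ne']; ring

open Classical in
lemma Hf_pair_count {ι κ : Type*} [Fintype ι] [Fintype κ] (m : Measure X) [IsProbabilityMeasure m]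
    {φ : X → ι} {ψ : X → κ} (hφ : MF φ) (hψ : MF ψ) (k : ℝ) (hk : 0 < k)
    (hc : ∀ b : κ, ((Finset.univ.filter fun a => ∃ x, φ x = a ∧ ψ x = b).card : ℝ) ≤ k) :
    Hf m (fun x => (φ x, ψ x)) ≤ Hf m ψ + Real.log k := by
  have hpi := hφ.prodMk hψ
  have hpos2 : ∀ A : ι × κ, 0 < pr m (fun x => (φ x, ψ x)) A → 0 < pr m ψ A.2 := by
    intro A hA
    exact hA.trans_le (pr_le_comp m (fun x => (φ x, ψ x)) Prod.snd A)
  have hex : ∀ A : ι × κ, 0 < pr m (fun x => (φ x, ψ x)) A → ∃ x, φ x = A.1 ∧ ψ x = A.2 := by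
    intro A hA
    by_contra hne
    have : (fun x => (φ x, ψ x)) ⁻¹' {A} = ∅ := by
      ext x
      simp only [mem_preimage, mem_singleton_iff, mem_empty_iff_false, iff_false]
      intro hx
      exact hne ⟨x, by rw [← hx], by rw [← hx]⟩
    unfold pr at hA
    rw [this] at hA
    simp at hA
  refine (gibbs m hpi (fun A => if ∃ x, φ x = A.1 ∧ ψ x = A.2 then pr m ψ A.2 / k else 0)
    (fun A => ?_) (fun A hA => ?_) ?_).trans_eq ?_
  · split_ifs
    · exact div_nonneg (pr_nonneg _ _ _) hk.le
    · exact le_rfl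
  · rw [if_pos (hex A hA)]
    exact div_pos (hpos2 A hA) hk
  · rw [Fintype.sum_prod_type_right, ← sum_pr m hψ]
    refine Finset.sum_le_sum fun b _ => ?_
    dsimp only
    rw [← Finset.sum_filter, Finset.sum_const, nsmul_eq_mul]
    have := mul_le_mul_of_nonneg_right (hc b) (div_nonneg (pr_nonneg m ψ b) hk.le)
    refine this.trans_eq ?_
    field_simp
  · have h2 : Hf m ψ =
        ∑ A, pr m (fun x => (φ x, ψ x)) A * (- Real.log (pr m ψ A.2)) := by
      rw [← sum_pr_comp m hpi Prod.snd (fun k => - Real.log (pr m ψ k))]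
      unfold Hf Real.negMulLog
      exact Finset.sum_congr rfl fun i _ => by ring
    have h3 : Real.log k = ∑ A, pr m (fun x => (φ x, ψ x)) A * Real.log k := by
      rw [← Finset.sum_mul, sum_pr m hpi, one_mul]
    rw [h2, h3, ← Finset.sum_add_distrib]
    refine Finset.sum_congr rfl fun A _ => ?_
    rcases (pr_nonneg m (fun x => (φ x, ψ x)) A).eq_or_lt with h0 | h0
    · rw [← h0]; simp
    · rw [if_pos (hex A h0), Real.log_div (hpos2 A h0).ne' hk.ne']; ring

lemma Hf_nonneg {ι : Type*} [Fintype ι] (m : Measure X) [IsProbabilityMeasure m]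
    (φ : X → ι) : 0 ≤ Hf m φ :=
  Finset.sum_nonneg fun i _ => Real.negMulLog_nonneg (pr_nonneg _ _ _) measureReal_le_one

lemma Hf_inv {ι : Type*} [Fintype ι] (m : Measure X) {T : X → X} (hT : Measurable T)
    (hm : Measure.map T m = m) {φ : X → ι} (hφ : MF φ) : Hf m (fun x => φ (T x)) = Hf m φ := by
  unfold Hf pr
  refine Finset.sum_congr rfl fun i _ => ?_
  conv_rhs => rw [← hm]
  rw [map_measureReal_apply hT (hφ i)]
  rfl

end Entropy

section Dyn

variable {X : Type*} [MetricSpace X]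

lemma zIter_eq (f : X ≃ₜ X) (j : ℤ) (x : X) :
    zIter f j x = ((f.toEquiv : Equiv.Perm X) ^ j) x := by
  cases j with
  | ofNat n =>
    simp only [zIter, Int.ofNat_eq_natCast, zpow_natCast]
    rw [Equiv.Perm.coe_pow]; rfl
  | negSucc n =>
    simp only [zIter, zpow_negSucc]
    rw [← inv_pow, Equiv.Perm.coe_pow]; rfl

lemma zIter_natCast (f : X ≃ₜ X) (n : ℕ) (x : X) : zIter f (n : ℤ) x = f^[n] x := rfl

lemma zIter_add (f : X ≃ₜ X) (i j : ℤ) (x : X) :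
    zIter f (i + j) x = zIter f i (zIter f j x) := by
  simp only [zIter_eq, zpow_add, Equiv.Perm.mul_apply]

lemma continuous_zIter (f : X ≃ₜ X) (j : ℤ) : Continuous (zIter f j) := by
  cases j with
  | ofNat n => exact f.continuous.iterate n
  | negSucc n => exact f.symm.continuous.iterate (n + 1)

lemma unif_exp [CompactSpace X] {f : X ≃ₜ X} {α : ℝ} (hα : IsExpansiveWith f α) {lam : ℝ}
    (hl : 0 < lam) : ∃ L : ℕ, ∀ x y : X, (∀ t ≤ 2 * L, dist (f^[t] x) (f^[t] y) ≤ α) →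
      dist (f^[L] x) (f^[L] y) < lam := by
  by_contra! hcon
  let A : ℕ → Set (X × X) := fun L => {p | lam ≤ dist p.1 p.2} ∩
    ⋂ (j : ℤ) (_ : |j| ≤ L), {p | dist (zIter f j p.1) (zIter f j p.2) ≤ α}
  have hcl : ∀ L, IsClosed (A L) := by
    intro L
    refine (isClosed_le continuous_const continuous_dist).inter ?_
    refine isClosed_iInter fun j => isClosed_iInter fun _ => ?_
    exact isClosed_le (((continuous_zIter f j).comp continuous_fst).dist
      ((continuous_zIter f j).comp continuous_snd)) continuous_const
  have hne : (⋂ L, A L).Nonempty := by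
    refine IsCompact.nonempty_iInter_of_sequence_nonempty_isCompact_isClosed A ?_ ?_
      (hcl 0).isCompact hcl
    · rintro L p ⟨hp1, hp2⟩
      refine ⟨hp1, ?_⟩
      simp only [mem_iInter, mem_ofPred_eq] at hp2 ⊢
      intro j hj
      exact hp2 j (by push_cast; omega)
    · intro L
      obtain ⟨x, y, hxy, hd⟩ := hcon L
      refine ⟨(f^[L] x, f^[L] y), hd, ?_⟩
      simp only [mem_iInter, mem_ofPred_eq]
      intro j hj
      rw [abs_le] at hj
      obtain ⟨t, ht⟩ := Int.eq_ofNat_of_zero_le (show 0 ≤ j + L by omega)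
      have := hxy t (by omega)
      rw [← zIter_natCast, ← zIter_natCast, ← ht, zIter_add, zIter_add, zIter_natCast,
        zIter_natCast] at this
      exact this
  obtain ⟨⟨x, y⟩, hp⟩ := hne
  rw [mem_iInter] at hp
  have hxy : x = y := by
    refine hα.2 x y fun n => ?_
    have := (hp n.natAbs).2
    simp only [mem_iInter, mem_ofPred_eq] at this
    exact this n (by simp)
  have := (hp 0).1
  simp only [mem_ofPred_eq, hxy, dist_self] at this
  linarith

/-- Closed Bowen balls. -/
def bb (f : X → X) (n : ℕ) (ε : ℝ) (x : X) : Set X := {y | ∀ j < n, dist (f^[j] y) (f^[j] x) ≤ ε}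

lemma isClosed_bb {f : X → X} (hf : Continuous f) (n : ℕ) (ε : ℝ) (x : X) :
    IsClosed (bb f n ε x) := by
  have : bb f n ε x = ⋂ (j : ℕ) (_ : j < n), {y | dist (f^[j] y) (f^[j] x) ≤ ε} := by
    ext; simp [bb]
  rw [this]
  refine isClosed_iInter fun j => isClosed_iInter fun _ => ?_
  exact isClosed_le ((hf.iterate j).dist continuous_const) continuous_const

lemma sep_bound [CompactSpace X] (f : X → X) {ε : ℝ} (hε : 0 < ε) :
    ∃ B : ℕ, ∀ (n : ℕ) (E : Finset X), IsSep f n ε ↑E → E.card ≤ B ^ n := by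
  classical
  obtain ⟨t, -, ht, hcov⟩ := finite_cover_balls_of_compact (isCompact_univ (X := X)) (half_pos hε)
  have : Fintype t := ht.fintype
  have hc : ∀ x : X, ∃ c : t, dist x c < ε / 2 := by
    intro x
    have := hcov (mem_univ x)
    simp only [mem_iUnion, Metric.mem_ball, exists_prop] at this
    obtain ⟨c, hc, hd⟩ := this
    exact ⟨⟨c, hc⟩, hd⟩
  choose c hc using hc
  refine ⟨Fintype.card t, fun n E hE => ?_⟩
  have hinj : Function.Injective (fun (e : E) (j : Fin n) => c (f^[j] e)) := by
    intro x y hxy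
    by_contra hne
    obtain ⟨j, hj, hd⟩ := hE x.2 y.2 (fun h => hne (Subtype.ext h))
    have h1 := congrFun hxy ⟨j, hj⟩
    simp only at h1
    have h2 := hc (f^[j] x)
    have h3 := hc (f^[j] y)
    rw [← h1, dist_comm] at h3
    linarith [dist_triangle (f^[j] (x : X)) (c (f^[j] x)) (f^[j] (y : X))]
  have := Fintype.card_le_of_injective _ hinj
  simpa using this

/-- Maximal cardinality of separated sets. -/
noncomputable def rn (f : X → X) (α : ℝ) (n : ℕ) : ℕ :=
  sSup {k | ∃ E : Finset X, IsSep f n α ↑E ∧ E.card = k}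

lemma rn_bdd [CompactSpace X] (f : X → X) {α : ℝ} (hα : 0 < α) (n : ℕ) :
    BddAbove {k | ∃ E : Finset X, IsSep f n α ↑E ∧ E.card = k} := by
  obtain ⟨B, hB⟩ := sep_bound f hα
  exact ⟨B ^ n, by rintro k ⟨E, hE, rfl⟩; exact hB n E hE⟩

lemma le_rn [CompactSpace X] (f : X → X) {α : ℝ} (hα : 0 < α) (n : ℕ) (E : Finset X)
    (hE : IsSep f n α ↑E) : E.card ≤ rn f α n :=
  le_csSup (rn_bdd f hα n) ⟨E, hE, rfl⟩

lemma exists_rn [CompactSpace X] (f : X → X) {α : ℝ} (hα : 0 < α) (n : ℕ) :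
    ∃ E : Finset X, IsSep f n α ↑E ∧ E.card = rn f α n :=
  Nat.sSup_mem (s := {k | ∃ E : Finset X, IsSep f n α ↑E ∧ E.card = k})
    ⟨0, ∅, by simp [IsSep], rfl⟩ (rn_bdd f hα n)

lemma rn_pos [CompactSpace X] [Nonempty X] (f : X → X) {α : ℝ} (hα : 0 < α) (n : ℕ) :
    1 ≤ rn f α n := by
  obtain ⟨x⟩ := ‹Nonempty X›
  exact le_rn f hα n {x} (by simp [IsSep])

lemma rn_le_pow [CompactSpace X] (f : X → X) {α : ℝ} (hα : 0 < α) :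
    ∃ B : ℕ, ∀ n, rn f α n ≤ B ^ n := by
  obtain ⟨B, hB⟩ := sep_bound f hα
  refine ⟨B, fun n => ?_⟩
  obtain ⟨E, hE, hc⟩ := exists_rn f hα n
  rw [← hc]; exact hB n E hE

lemma spanning {g : X → X} {K : Set X} {n : ℕ} {ε : ℝ} (hε : 0 ≤ ε) {E : Finset X}
    (hEK : ↑E ⊆ K) (hE : IsSep g n ε ↑E)
    (hmax : ∀ E' : Finset X, ↑E' ⊆ K → IsSep g n ε ↑E' → E'.card ≤ E.card) :
    ∀ x ∈ K, ∃ e ∈ E, x ∈ bb g n ε e := by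
  classical
  intro x hx
  by_contra! hcon
  have hxE : x ∉ E := by
    intro hxE
    refine hcon x hxE ?_
    intro j _
    simpa using hε
  have := hmax (insert x E) (by
    rw [Finset.coe_insert]; exact insert_subset hx hEK) (by
    rw [Finset.coe_insert]
    unfold IsSep
    rw [Set.pairwise_insert]
    refine ⟨hE, fun e he _ => ?_⟩
    have := hcon e he
    simp only [bb, mem_ofPred_eq, not_forall, not_le] at this
    obtain ⟨j, hj, hd⟩ := this
    exact ⟨⟨j, hj, hd⟩, ⟨j, hj, by rwa [dist_comm]⟩⟩)
  rw [Finset.card_insert_of_notMem hxE] at this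
  omega

lemma spec_two {f : X ≃ₜ X} (hspec : HasSpecification f) {ε : ℝ} (hε : 0 < ε) :
    ∃ M : ℕ, 1 ≤ M ∧ ∀ (n q : ℕ) (x y : X), ∃ z : X, z ∈ perSet f (n + q + 2 * M) ∧
      z ∈ bb f n ε x ∧ f^[n + M] z ∈ bb f q ε y := by
  obtain ⟨M, hM⟩ := hspec ε hε
  refine ⟨M + 1, by omega, fun n q x y => ?_⟩
  obtain ⟨z, hz, hd⟩ := hM 1 ![x, zIter f (-((n + (M + 1) : ℕ) : ℤ)) y]
    ![0, ((n + (M + 1) : ℕ) : ℤ)] ![(n : ℤ), ((n + (M + 1) + q : ℕ) : ℤ)]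
    (by
      intro i
      fin_cases i
      · simp
      · simp only [Fin.mk_one, Matrix.cons_val_one, Matrix.cons_val_zero]; push_cast; omega)
    (by
      intro i
      fin_cases i
      simp only [Fin.zero_eta, Fin.succ_zero_eq_one, Matrix.cons_val_one, Matrix.cons_val_zero,
        Fin.castSucc_zero]
      push_cast; omega)
    ((n + q + 2 * (M + 1) : ℕ) : ℤ) (by
      have : Fin.last 1 = 1 := rfl
      simp only [this, Matrix.cons_val_one, Matrix.cons_val_zero]
      push_cast; omega)
  refine ⟨z, hz, ?_, ?_⟩
  · intro j hj
    have := hd 0 (j : ℤ) (by simp) (by simp; omega)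
    exact this
  · intro j hj
    have := hd 1 ((n + (M + 1) : ℕ) + (j : ℤ))
      (by simp only [Matrix.cons_val_one, Matrix.cons_val_zero]; omega)
      (by simp only [Matrix.cons_val_one, Matrix.cons_val_zero]; push_cast; omega)
    simp only [Matrix.cons_val_one, Matrix.cons_val_zero] at this
    rw [← zIter_add, show (((n + (M + 1) : ℕ) : ℤ) + (j : ℤ) + (-((n + (M + 1) : ℕ) : ℤ))) = j by
      ring, add_comm, zIter_add] at this
    exact this

lemma zIter_mod {f : X ≃ₜ X} {m : ℕ} {x : X} (hx : x ∈ perSet f m) (j : ℤ) :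
    zIter f j x = zIter f (j % m) x := by
  have h1 : ((f.toEquiv : Equiv.Perm X) ^ m) x = x := by
    rw [Equiv.Perm.coe_pow]; exact hx
  have h2 := Equiv.Perm.zpow_apply_eq_self_of_apply_eq_self h1 (j / m)
  conv_lhs => rw [← Int.emod_add_mul_ediv j m]
  rw [zIter_add]
  congr 1
  rw [zIter_eq, zpow_mul, zpow_natCast]
  exact h2

lemma per_sep {f : X ≃ₜ X} {α : ℝ} (hα : IsExpansiveWith f α) {m : ℕ} (hm : 1 ≤ m) {S : Set X}
    (hS : S ⊆ perSet f m) : IsSep f m α S := by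
  intro x hx y hy hne
  by_contra! hcon
  refine hne (hα.2 x y fun n => ?_)
  rw [zIter_mod (hS hx), zIter_mod (hS hy)]
  obtain ⟨t, ht⟩ := Int.eq_ofNat_of_zero_le (Int.emod_nonneg n (show (m : ℤ) ≠ 0 by omega))
  have h3 := Int.emod_lt_of_pos n (show 0 < (m : ℤ) by omega)
  rw [ht]
  exact hcon t (by omega)

lemma per_finite [CompactSpace X] {f : X ≃ₜ X} {α : ℝ} (hα : IsExpansiveWith f α) {m : ℕ}
    (hm : 1 ≤ m) : (perSet f m).Finite := by
  by_contra hinf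
  obtain ⟨S, hS, hc⟩ := Set.Infinite.exists_subset_card_eq hinf (rn f α m + 1)
  have := le_rn f hα.1 m S (per_sep hα hm hS)
  omega

lemma growth [CompactSpace X] {f : X ≃ₜ X} {α : ℝ} (hα : IsExpansiveWith f α)
    (hspec : HasSpecification f) :
    ∃ W : ℕ, 1 ≤ W ∧ (∀ n q, rn f α n * rn f α q ≤ rn f α (n + q + W)) ∧
      (∀ x n q, ∃ S : Finset X, ↑S ⊆ perSet f (n + q + W) ∩ bb f n (α / 2) x ∧
        S.card = rn f α q) := by
  classical
  obtain ⟨M, hM1, hM⟩ := spec_two hspec (half_pos hα.1)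
  choose z hz1 hz2 hz3 using hM
  have hsep : ∀ (n : ℕ) (F : Set X), IsSep f n α F → ∀ (w x y : X), x ∈ F → y ∈ F →
      w ∈ bb f n (α / 2) x → w ∈ bb f n (α / 2) y → x = y := by
    intro n F hF w x y hx hy h1 h2
    by_contra hne
    obtain ⟨j, hj, hd⟩ := hF hx hy hne
    have h3 := h1 j hj
    have h4 := h2 j hj
    rw [dist_comm] at h3
    linarith [dist_triangle (f^[j] x) (f^[j] w) (f^[j] y)]
  refine ⟨2 * M, by omega, fun n q => ?_, fun x n q => ?_⟩
  · obtain ⟨E, hE, hEc⟩ := exists_rn f hα.1 n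
    obtain ⟨F, hF, hFc⟩ := exists_rn f hα.1 q
    rw [← hEc, ← hFc, ← Finset.card_product]
    have hinj : Set.InjOn (fun p : X × X => z n q p.1 p.2) ↑(E ×ˢ F) := by
      rintro ⟨a, b⟩ hab ⟨c, d⟩ hcd heq
      simp only [Finset.coe_product, Set.mem_prod, Finset.mem_coe] at hab hcd
      simp only at heq
      have h1 : a = c := by
        refine hsep n _ hE (z n q a b) a c hab.1 hcd.1 (hz2 n q a b) ?_
        rw [heq]; exact hz2 n q c d
      have h2 : b = d := by
        refine hsep q _ hF (f^[n + M] (z n q a b)) b d hab.2 hcd.2 (hz3 n q a b) ?_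
        rw [heq]; exact hz3 n q c d
      rw [h1, h2]
    rw [← Finset.card_image_of_injOn hinj]
    refine le_rn f hα.1 _ _ (per_sep hα (by omega) ?_)
    intro w hw
    simp only [Finset.coe_image, Set.mem_image] at hw
    obtain ⟨p, -, rfl⟩ := hw
    exact hz1 n q _ _
  · obtain ⟨F, hF, hFc⟩ := exists_rn f hα.1 q
    have hinj : Set.InjOn (fun y : X => z n q x y) ↑F := by
      intro b hb d hd heq
      simp only at heq
      refine hsep q _ hF (f^[n + M] (z n q x b)) b d hb hd (hz3 n q x b) ?_
      rw [heq]; exact hz3 n q x d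
    refine ⟨F.image (fun y => z n q x y), ?_, by rw [Finset.card_image_of_injOn hinj, hFc]⟩
    intro w hw
    simp only [Finset.coe_image, Set.mem_image] at hw
    obtain ⟨p, -, rfl⟩ := hw
    exact ⟨hz1 n q _ _, hz2 n q _ _⟩

end Dyn

section Rate

lemma rate_pow (r : ℕ → ℕ) (W : ℕ) (hpos : ∀ n, 1 ≤ r n)
    (hsup : ∀ n q, r n * r q ≤ r (n + q + W)) (n k : ℕ) : r n ^ k ≤ r (k * (n + W)) := by
  induction k with
  | zero => simpa using hpos 0
  | succ k ih =>
    calc r n ^ (k + 1) = r n ^ k * r n := pow_succ _ _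
      _ ≤ r (k * (n + W)) * r n := Nat.mul_le_mul_right _ ih
      _ ≤ r (k * (n + W) + n + W) := hsup _ _
      _ = r ((k + 1) * (n + W)) := by congr 1; ring

lemma rate (r : ℕ → ℕ) (W : ℕ) (hW : 1 ≤ W) (hpos : ∀ n, 1 ≤ r n) (B : ℕ)
    (hB : ∀ n, r n ≤ B ^ n) :
    ∃ hh : ℝ, 0 ≤ hh ∧ (∀ n : ℕ, (r n : ℝ) ≤ Real.exp ((n + W) * hh)) ∧
      (∀ c < hh, ∃ n : ℕ, c < Real.log (r n) / (n + W)) ∧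
      (∀ q m0 : ℕ, ∃ m ≥ m0, Real.exp (- (q * hh)) / 2 * r (m + q) ≤ r m) := by
  have hW' : (1 : ℝ) ≤ W := by exact_mod_cast hW
  have hden : ∀ n : ℕ, (0 : ℝ) < n + W := fun n => by positivity
  have hr1 : ∀ n, (1 : ℝ) ≤ r n := fun n => by exact_mod_cast hpos n
  have hbdd : BddAbove (Set.range fun n : ℕ => Real.log (r n) / (n + W)) := by
    refine ⟨Real.log (B + 1), ?_⟩
    rintro _ ⟨n, rfl⟩
    simp only
    rw [div_le_iff₀ (hden n)]
    have h1 : (r n : ℝ) ≤ (B + 1 : ℝ) ^ n := by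
      have : (r n : ℝ) ≤ (B : ℝ) ^ n := by exact_mod_cast hB n
      exact this.trans (pow_le_pow_left₀ (by positivity) (by linarith) n)
    have h2 := Real.log_le_log (by linarith [hr1 n]) h1
    rw [Real.log_pow] at h2
    have h3 : 0 ≤ Real.log (B + 1 : ℝ) := Real.log_nonneg (by linarith [(Nat.cast_nonneg B : (0:ℝ) ≤ B)])
    nlinarith
  have hle : ∀ n : ℕ, Real.log (r n) / (n + W) ≤ ⨆ n : ℕ, Real.log (r n) / (n + W) :=
    fun n => le_ciSup hbdd n
  set hh := ⨆ n : ℕ, Real.log (r n) / (n + W) with hhdef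
  have h0 : 0 ≤ hh := (div_nonneg (Real.log_nonneg (hr1 0)) (hden 0).le).trans (hle 0)
  have hup : ∀ n : ℕ, (r n : ℝ) ≤ Real.exp ((n + W) * hh) := by
    intro n
    rw [← Real.log_le_iff_le_exp (by linarith [hr1 n]), mul_comm]
    exact (div_le_iff₀ (hden n)).1 (hle n)
  refine ⟨hh, h0, hup, fun c hc => exists_lt_of_lt_ciSup hc, fun q m0 => ?_⟩
  by_contra! hcon
  have hstep : ∀ m ≥ m0, 2 * Real.exp (q * hh) * r m ≤ r (m + q) := by
    intro m hm
    have h1 := (hcon m hm).le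
    have h2 : Real.exp (q * hh) * Real.exp (-(q * hh)) = 1 := by
      rw [← Real.exp_add]; simp
    calc 2 * Real.exp (q * hh) * r m
        ≤ 2 * Real.exp (q * hh) * (Real.exp (-(q * hh)) / 2 * r (m + q)) := by gcongr
      _ = (Real.exp (q * hh) * Real.exp (-(q * hh))) * r (m + q) := by ring
      _ = r (m + q) := by rw [h2, one_mul]
  have hind : ∀ j : ℕ, (2 * Real.exp (q * hh)) ^ j ≤ r (m0 + j * q) := by
    intro j
    induction j with
    | zero => simpa using hr1 m0
    | succ j ih =>
      calc (2 * Real.exp (q * hh)) ^ (j + 1)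
          = 2 * Real.exp (q * hh) * (2 * Real.exp (q * hh)) ^ j := by ring
        _ ≤ 2 * Real.exp (q * hh) * r (m0 + j * q) := by gcongr
        _ ≤ r (m0 + j * q + q) := hstep _ (by omega)
        _ = r (m0 + (j + 1) * q) := by congr 2; ring
  have hfin : ∀ j : ℕ, (2 : ℝ) ^ j ≤ Real.exp ((m0 + W) * hh) := by
    intro j
    have h1 := (hind j).trans (hup _)
    rw [mul_pow, ← Real.exp_nat_mul] at h1
    have h2 : ((m0 + j * q : ℕ) + W : ℝ) * hh = (m0 + W) * hh + j * (q * hh) := by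
      push_cast; ring
    rw [h2, Real.exp_add] at h1
    exact le_of_mul_le_mul_right h1 (Real.exp_pos _)
  obtain ⟨j, hj⟩ := pow_unbounded_of_one_lt (Real.exp ((m0 + W) * hh)) (one_lt_two (α := ℝ))
  exact absurd (hfin j) (not_le.2 hj)

lemma rn_le_sepCard {X : Type*} [MetricSpace X] [CompactSpace X] {f g : X → X} {h : X → X}
    (hcont : Continuous h) (hsurj : Function.Surjective h) (hsemi : ∀ x : X, f (h x) = h (g x))
    {α : ℝ} (hα : 0 < α) : ∃ ε > 0, ∀ m, (rn f α m : ℝ≥0∞) ≤ sepCard g Set.univ m ε := by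
  classical
  have huc := CompactSpace.uniformContinuous_of_continuous hcont
  rw [Metric.uniformContinuous_iff] at huc
  obtain ⟨δ, hδ, hd⟩ := huc α hα
  refine ⟨δ / 2, half_pos hδ, fun m => ?_⟩
  obtain ⟨E, hE, hc⟩ := exists_rn f hα m
  have hs : ∀ (j : ℕ) x, h (g^[j] x) = f^[j] (h x) := fun j =>
    (Function.Semiconj.iterate_right (f := h) (ga := g) (gb := f) (fun x => (hsemi x).symm) j)
  have hinv := Function.surjInv_eq hsurj
  have hinj : Function.Injective (Function.surjInv hsurj) := Function.injective_surjInv hsurj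
  rw [← hc, ← Finset.card_image_of_injective E hinj]
  refine le_iSup₂_of_le (E.image (Function.surjInv hsurj)) ⟨Set.subset_univ _, ?_⟩ le_rfl
  rw [Finset.coe_image]
  rintro _ ⟨x, hx, rfl⟩ _ ⟨y, hy, rfl⟩ hne
  obtain ⟨j, hj, hdd⟩ := hE hx hy (fun h => hne (by rw [h]))
  refine ⟨j, hj, ?_⟩
  by_contra! hcon
  have := hd (hcon.trans_lt (half_lt_self hδ))
  rw [hs, hs, hinv, hinv] at this
  linarith

lemma le_topEntropy {X : Type*} [MetricSpace X] [CompactSpace X] [Nonempty X] {f g : X → X}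
    {h : X → X}
    (hcont : Continuous h) (hsurj : Function.Surjective h) (hsemi : ∀ x : X, f (h x) = h (g x))
    {α : ℝ} (hα : 0 < α) {W : ℕ} (hW : 1 ≤ W)
    (hsup : ∀ n q, rn f α n * rn f α q ≤ rn f α (n + q + W)) {hh : ℝ}
    (hlt : ∀ c < hh, ∃ n : ℕ, c < Real.log (rn f α n) / (n + W)) :
    (hh : EReal) ≤ topEntropy g := by
  obtain ⟨ε, hε, hS⟩ := rn_le_sepCard hcont hsurj hsemi hα
  refine EReal.ge_of_forall_gt_iff_ge.1 fun c hc => ?_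
  obtain ⟨n, hn⟩ := hlt c (by exact_mod_cast hc)
  have hW' : (1 : ℝ) ≤ W := by exact_mod_cast hW
  have hden : (0 : ℝ) < n + W := by positivity
  rw [lt_div_iff₀ hden] at hn
  have hfreq : ∃ᶠ m : ℕ in atTop,
      (c : EReal) ≤ ENNReal.log (sepCard g Set.univ m ε) / (m : EReal) := by
    rw [Filter.frequently_atTop]
    intro a
    refine ⟨(a + 1) * (n + W), by nlinarith, ?_⟩
    have hm : 0 < (a + 1) * (n + W) := by positivity
    rw [EReal.le_div_iff_mul_le (by exact_mod_cast hm) (EReal.natCast_ne_top _)]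
    have h1 : (rn f α n ^ (a + 1) : ℕ) ≤ sepCard g Set.univ ((a + 1) * (n + W)) ε :=
      le_trans (by exact_mod_cast rate_pow (rn f α) W (rn_pos f hα) hsup n (a + 1)) (hS _)
    have h2 := ENNReal.log_monotone h1
    refine le_trans ?_ h2
    have hr : (0 : ℝ) < rn f α n := by exact_mod_cast rn_pos f hα n
    have h3 : ((rn f α n ^ (a + 1) : ℕ) : ℝ≥0∞) = ENNReal.ofReal ((rn f α n : ℝ) ^ (a + 1)) := by
      rw [← ENNReal.ofReal_natCast]; push_cast; rfl
    rw [h3, ENNReal.log_ofReal_of_pos (by positivity), Real.log_pow]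
    have h4 : c * (((a + 1) * (n + W) : ℕ) : ℝ) ≤ ((a + 1 : ℕ) : ℝ) * Real.log (rn f α n) := by
      push_cast
      have : (0 : ℝ) ≤ a + 1 := by positivity
      nlinarith
    exact_mod_cast h4
  refine (Filter.le_limsup_of_frequently_le hfreq).trans ?_
  exact le_iSup₂ (f := fun (ε : ℝ) (_ : 0 < ε) =>
    Filter.limsup (fun n : ℕ => ENNReal.log (sepCard g Set.univ n ε) / (n : EReal)) atTop) ε hε

end Rate

section Meas

variable {X : Type*} [MetricSpace X] [CompactSpace X] [MeasurableSpace X] [BorelSpace X]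

lemma integral_unif (s : Finset X) (φ : X → ℝ) :
    ∫ x, φ x ∂(ProbabilityTheory.uniformOn (s : Set X)) = (∑ x ∈ s, φ x) / s.card := by
  unfold ProbabilityTheory.uniformOn ProbabilityTheory.cond
  rw [integral_smul_measure, setIntegral_finset s]
  · simp [Measure.real, div_eq_inv_mul]
  · have : (s : Set X) = ⋃ x ∈ s, {x} := by ext y; simp
    rw [this, integrableOn_finset_iUnion]
    exact fun x _ => integrableOn_singleton (by simp) (by simp [Measure.count_singleton])

lemma measure_eq_of_integral {m₁ m₂ : Measure X} [IsFiniteMeasure m₁] [IsFiniteMeasure m₂]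
    (hh : ∀ φ : C(X, ℝ), ∫ x, φ x ∂m₁ = ∫ x, φ x ∂m₂) : m₁ = m₂ := by
  refine ext_of_forall_integral_eq_of_IsFiniteMeasure fun φ => ?_
  exact hh φ.toContinuousMap

/-- Lower bound for closed sets of weak limits. -/
lemma closed_lower {μs : ℕ → Measure X} {μ : Measure X} [IsFiniteMeasure μ]
    (hμ : WeakLimit μs μ) {B : Set X} (hB : IsClosed B) {c : ℝ}
    (hc : ∃ᶠ m in atTop, ∀ φ : C(X, ℝ), (∀ x, 0 ≤ φ x) → (∀ x ∈ B, φ x = 1) →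
      c ≤ ∫ x, φ x ∂(μs m)) : c ≤ μ.real B := by
  by_contra! hlt
  obtain ⟨U, hBU, hU, hμU⟩ := B.exists_isOpen_lt_of_lt (μ := μ) (ENNReal.ofReal c) (by
    rw [ENNReal.lt_ofReal_iff_toReal_lt (measure_ne_top _ _)]; exact hlt)
  have hμU' : μ.real U < c := by
    rw [ENNReal.lt_ofReal_iff_toReal_lt (measure_ne_top _ _)] at hμU; exact hμU
  obtain ⟨φ, h0, h1, h01⟩ := exists_continuous_zero_one_of_isClosed hU.isClosed_compl hB
    (Set.disjoint_left.2 fun x hx hx' => hx (hBU hx'))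
  have hle : ∫ x, φ x ∂μ ≤ μ.real U := by
    have : ∫ x, U.indicator (fun _ => (1 : ℝ)) x ∂μ = μ.real U := by
      rw [integral_indicator hU.measurableSet]; simp
    rw [← this]
    refine integral_mono_of_nonneg (ae_of_all _ fun x => (h01 x).1)
      ((integrable_const _).indicator hU.measurableSet) (ae_of_all _ fun x => ?_)
    by_cases hx : x ∈ U
    · simp [hx, (h01 x).2]
    · have := h0 hx
      simp [hx, this]
  have hge : c ≤ ∫ x, φ x ∂μ :=
    ge_of_tendsto_of_frequently (hμ φ) (hc.mono fun m hm => hm φ (fun x => (h01 x).1)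
      (fun x hx => h1 hx))
  linarith

lemma mu_inv {f : X ≃ₜ X} {α : ℝ} (hα : IsExpansiveWith f α) {μ : Measure X}
    [IsProbabilityMeasure μ] (hμ : WeakLimit (perMeasure (⇑f)) μ) : Measure.map f μ = μ := by
  have : IsProbabilityMeasure (Measure.map f μ) :=
    Measure.isProbabilityMeasure_map f.continuous.measurable.aemeasurable
  refine measure_eq_of_integral fun φ => ?_
  rw [integral_map f.continuous.measurable.aemeasurable φ.continuous.aestronglyMeasurable]
  have h1 := hμ φ
  have h2 := hμ (φ.comp (f : C(X, X)))
  refine tendsto_nhds_unique h2 (h1.congr' ?_)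
  filter_upwards [eventually_ge_atTop 1] with n hn
  have hfin := per_finite hα hn
  unfold perMeasure
  rw [← hfin.coe_toFinset, integral_unif, integral_unif]
  congr 1
  refine (Finset.sum_bij (fun x _ => f x) ?_ ?_ ?_ ?_).symm
  · intro x hx
    rw [hfin.mem_toFinset] at hx ⊢
    change f^[n] x = x at hx
    change f^[n] (f x) = f x
    rw [← Function.iterate_succ_apply, Function.iterate_succ_apply', hx]
  · intro x _ y _ hxy
    exact f.injective hxy
  · intro y hy
    refine ⟨f.symm y, ?_, by simp⟩
    rw [hfin.mem_toFinset] at hy ⊢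
    change f^[n] y = y at hy
    change f^[n] (f.symm y) = f.symm y
    apply f.injective
    rw [← Function.iterate_succ_apply' (⇑f) n, Function.iterate_succ_apply]
    simpa using hy
  · intro x _
    rfl

lemma mu_lower [Nonempty X] {f : X ≃ₜ X} {α : ℝ} (hα : IsExpansiveWith f α) {μ : Measure X}
    [IsProbabilityMeasure μ] (hμ : WeakLimit (perMeasure (⇑f)) μ) {W : ℕ} (hW : 1 ≤ W)
    (hS : ∀ x n q, ∃ S : Finset X, ↑S ⊆ perSet f (n + q + W) ∩ bb f n (α / 2) x ∧
        S.card = rn f α q) {hh : ℝ}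
    (hrate : ∀ q m0 : ℕ, ∃ m ≥ m0, Real.exp (- (q * hh)) / 2 * rn f α (m + q) ≤ rn f α m)
    (n : ℕ) (x : X) : Real.exp (- ((n + W) * hh)) / 2 ≤ μ.real (bb f n (α / 2) x) := by
  refine closed_lower hμ (isClosed_bb f.continuous _ _ _) ?_
  rw [Filter.frequently_atTop]
  intro a
  obtain ⟨q, hq, hr⟩ := hrate (n + W) a
  refine ⟨n + q + W, by omega, fun φ h0 h1 => ?_⟩
  obtain ⟨S, hSs, hSc⟩ := hS x n q
  have hfin := per_finite hα (show 1 ≤ n + q + W by omega)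
  have hSsub : S ⊆ hfin.toFinset := fun z hz => by
    rw [hfin.mem_toFinset]; exact (hSs hz).1
  have hcard : hfin.toFinset.card ≤ rn f α (n + q + W) :=
    le_rn f hα.1 _ _ (per_sep hα (by omega) (by simp))
  have hpos : 0 < hfin.toFinset.card := by
    have := Finset.card_le_card hSsub
    have := rn_pos f hα.1 q
    omega
  unfold perMeasure
  rw [← hfin.coe_toFinset, integral_unif, le_div_iff₀ (by exact_mod_cast hpos)]
  have hsum : (S.card : ℝ) ≤ ∑ z ∈ hfin.toFinset, φ z := by
    calc (S.card : ℝ) = ∑ z ∈ S, φ z := by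
          rw [Finset.sum_congr rfl fun z hz => h1 z (hSs hz).2]; simp
      _ ≤ _ := Finset.sum_le_sum_of_subset_of_nonneg hSsub fun z _ _ => h0 z
  refine le_trans ?_ hsum
  rw [hSc]
  refine le_trans ?_ hr
  rw [show q + (n + W) = n + q + W by ring]
  push_cast
  gcongr

end Meas

section Gap

variable {X : Type*} [MetricSpace X] [CompactSpace X] [MeasurableSpace X] [BorelSpace X]

lemma measurable_choice {X : Type*} [MeasurableSpace X] {k : ℕ} (c : Fin k → Set X)
    (hc : ∀ i, MeasurableSet (c i)) (hcov : ∀ x, ∃ i, x ∈ c i) :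
    ∃ β : X → Fin k, MF β ∧ ∀ x, x ∈ c (β x) := by
  classical
  have hex : ∀ x, ∃ i, x ∈ c i ∧ ∀ j < i, x ∉ c j := by
    intro x
    obtain ⟨i, hi, hmin⟩ := WellFounded.has_min (wellFounded_lt (α := Fin k)) {i | x ∈ c i} (hcov x)
    exact ⟨i, hi, fun j hj hx => hmin j hx hj⟩
  choose β h1 h2 using hex
  refine ⟨β, fun i => ?_, h1⟩
  have : β ⁻¹' {i} = c i \ ⋃ (j : Fin k) (_ : j < i), c j := by
    ext x
    simp only [mem_preimage, mem_singleton_iff, Set.mem_sdiff, mem_iUnion, not_exists]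
    constructor
    · rintro rfl
      exact ⟨h1 x, h2 x⟩
    · rintro ⟨h3, h4⟩
      rcases lt_trichotomy (β x) i with h | h | h
      · exact absurd (h1 x) (h4 _ h)
      · exact h
      · exact absurd h3 (h2 x _ h)
  rw [this]
  exact (hc i).diff (MeasurableSet.iUnion fun j => MeasurableSet.iUnion fun _ => hc j)

lemma gap {f : X ≃ₜ X} {α : ℝ} (hα : 0 < α) (hα2 : IsExpansiveWith f (2 * α))
    {μ η : Measure X} [IsProbabilityMeasure μ] [IsProbabilityMeasure η]
    (hμ : MeasurePreserving f μ μ) (hη : MeasurePreserving f η η) {W : ℕ} {hh : ℝ} (h0 : 0 ≤ hh)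
    (hup : ∀ n : ℕ, (rn f α n : ℝ) ≤ Real.exp ((n + W) * hh))
    (hlow : ∀ (n : ℕ) (x : X), Real.exp (- ((n + W) * hh)) / 2 ≤ μ.real (bb f n (α / 2) x))
    (hsmall : ∀ κ > 0, ∃ K : Set X, IsCompact K ∧ 1 - κ ≤ η.real K ∧
      ∃ U, IsOpen U ∧ K ⊆ U ∧ μ.real U ≤ κ) :
    ∃ N : ℕ, 1 ≤ N ∧ ∃ (k : ℕ) (β : X → Fin k), MF β ∧
      (∀ x y, β x = β y → ∀ j < N, dist (f^[j] x) (f^[j] y) ≤ 2 * α) ∧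
      Hf η β ≤ N * hh - 1 := by
  classical
  set D := Real.log 2 + W * hh + 1 with hD
  have hlog2 : 0 < Real.log 2 := Real.log_pos one_lt_two
  have hDpos : 0 < D := by positivity
  set κ := min (1 / 4 : ℝ) (Real.exp (-2 * D) / 2) with hκ
  have hκpos : 0 < κ := by positivity
  have hκ1 : κ ≤ 1 / 4 := min_le_left _ _
  have hκ2 : κ ≤ Real.exp (-2 * D) / 2 := min_le_right _ _
  have hlogκ : Real.log (2 * κ) ≤ -2 * D := by
    rw [Real.log_le_iff_le_exp (by positivity)]; linarith
  obtain ⟨K, hK, hηK, U, hU, hKU, hμU⟩ := hsmall κ hκpos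
  obtain ⟨ρ, hρ, hthick⟩ := hK.exists_thickening_subset_open hU hKU
  obtain ⟨L, hL⟩ := unif_exp hα2 hρ
  set N := 2 * L + 1 with hN
  refine ⟨N, by omega, ?_⟩
  obtain ⟨E, hE, hEc⟩ := exists_rn f hα N
  have hspan := spanning (K := Set.univ) hα.le (Set.subset_univ _) hE
    (fun E' _ hE' => by rw [hEc]; exact le_rn f hα N E' hE')
  let e : Fin (rn f α N) ≃ E := (finCongr hEc.symm).trans E.equivFin.symm
  obtain ⟨β, hβ, hβ2⟩ := measurable_choice (fun i => bb f N α (e i : X))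
    (fun i => (isClosed_bb f.continuous _ _ _).measurableSet) (fun x => by
      obtain ⟨a, ha, hx⟩ := hspan x (mem_univ x)
      exact ⟨e.symm ⟨a, ha⟩, by simpa using hx⟩)
  have hclose : ∀ i x y, x ∈ bb f N α (e i : X) → y ∈ bb f N α (e i : X) → ∀ j < N,
      dist (f^[j] x) (f^[j] y) ≤ 2 * α := by
    intro i x y hx hy j hj
    have h1 := hx j hj
    have h2 := hy j hj
    rw [dist_comm] at h2
    linarith [dist_triangle (f^[j] x) (f^[j] (e i : X)) (f^[j] y)]
  refine ⟨rn f α N, β, hβ, fun x y hxy => ?_, ?_⟩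
  · refine hclose (β x) x y (hβ2 x) ?_
    rw [hxy]; exact hβ2 y
  set T := Real.exp ((N + W) * hh) with hT
  have hTpos : 0 < T := Real.exp_pos _
  let G : Finset (Fin (rn f α N)) :=
    Finset.univ.filter fun i => ∃ x ∈ bb f N α (e i : X), f^[L] x ∈ K
  -- the cardinality of `G`
  have hGcard : (G.card : ℝ) ≤ 2 * κ * T := by
    have hdisj : (G : Set (Fin (rn f α N))).PairwiseDisjoint
        (fun i => bb f N (α / 2) (e i : X)) := by
      intro i _ j _ hij
      refine Set.disjoint_left.2 fun x hx hy => ?_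
      have hne : (e i : X) ≠ e j := fun h => hij (e.injective (Subtype.ext h))
      obtain ⟨t, ht, hd⟩ := hE (e i).2 (e j).2 hne
      have h1 := hx t ht
      have h2 := hy t ht
      rw [dist_comm] at h1
      linarith [dist_triangle (f^[t] (e i : X)) (f^[t] x) (f^[t] (e j : X))]
    have hsub : (⋃ i ∈ G, bb f N (α / 2) (e i : X)) ⊆ f^[L] ⁻¹' U := by
      intro x hx
      simp only [mem_iUnion, exists_prop] at hx
      obtain ⟨i, hi, hx⟩ := hx
      obtain ⟨y, hy, hyK⟩ := (Finset.mem_filter.1 hi).2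
      refine hthick ?_
      rw [Metric.mem_thickening_iff]
      refine ⟨f^[L] y, hyK, hL x y fun t ht => hclose i x y ?_ hy t (by omega)⟩
      intro j hj
      have := hx j hj
      linarith
    have h1 : ∑ i ∈ G, μ.real (bb f N (α / 2) (e i : X)) ≤ κ := by
      rw [← measureReal_biUnion_finset hdisj
        (fun i _ => (isClosed_bb f.continuous _ _ _).measurableSet)]
      refine (measureReal_mono hsub).trans ?_
      rw [(hμ.iterate L).measureReal_preimage hU.measurableSet.nullMeasurableSet]
      exact hμU
    have h2 : (G.card : ℝ) * (T⁻¹ / 2) ≤ κ := by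
      refine le_trans ?_ h1
      rw [← nsmul_eq_mul]
      refine Finset.card_nsmul_le_sum _ _ _ fun i _ => ?_
      rw [hT, ← Real.exp_neg]
      exact hlow N _
    have h3 : (G.card : ℝ) = (G.card : ℝ) * (T⁻¹ / 2) * (2 * T) := by field_simp
    rw [h3]
    nlinarith
  -- the mass of `G`
  have hGmass : 1 / 2 ≤ ∑ i ∈ G, pr η β i := by
    have h1 : ∑ i ∈ G, pr η β i = η.real (⋃ i ∈ G, β ⁻¹' {i}) := by
      rw [measureReal_biUnion_finset]
      · rfl
      · intro i _ j _ hij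
        refine Set.disjoint_left.2 fun x hx hy => hij ?_
        simp only [mem_preimage, mem_singleton_iff] at hx hy
        rw [← hx, ← hy]
      · exact fun i _ => hβ i
    rw [h1]
    have h2 : η.real (f^[L] ⁻¹' K) ≤ η.real (⋃ i ∈ G, β ⁻¹' {i}) := by
      refine measureReal_mono ?_ (measure_ne_top _ _)
      intro x hx
      simp only [mem_iUnion, exists_prop]
      exact ⟨β x, Finset.mem_filter.2 ⟨Finset.mem_univ _, x, hβ2 x, hx⟩, rfl⟩
    rw [(hη.iterate L).measureReal_preimage hK.isClosed.measurableSet.nullMeasurableSet] at h2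
    linarith
  have hq := gibbs η hβ (fun i => if i ∈ G then (2 * (2 * κ * T))⁻¹ else (2 * T)⁻¹)
    (fun i => by split_ifs <;> positivity) (fun i _ => by split_ifs <;> positivity) (by
      rw [Finset.sum_ite]
      simp only [Finset.sum_const, nsmul_eq_mul]
      have h1 : ((Finset.univ.filter fun i => i ∈ G).card : ℝ) * (2 * (2 * κ * T))⁻¹ ≤ 1 / 2 := by
        have : (Finset.univ.filter fun i => i ∈ G) = G := by ext; simp
        rw [this, ← div_eq_mul_inv, div_le_iff₀ (by positivity)]
        linarith
      have h2 : ((Finset.univ.filter fun i => i ∉ G).card : ℝ) * (2 * T)⁻¹ ≤ 1 / 2 := by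
        have h3 : ((Finset.univ.filter fun i => i ∉ G).card : ℝ) ≤ T := by
          refine le_trans ?_ (hup N)
          have := Finset.card_filter_le (Finset.univ : Finset (Fin (rn f α N))) (fun i => i ∉ G)
          rw [Finset.card_univ, Fintype.card_fin] at this
          exact_mod_cast this
        rw [← div_eq_mul_inv, div_le_iff₀ (by positivity)]
        linarith
      linarith)
  refine hq.trans ?_
  have hlogT : Real.log T = (N + W) * hh := Real.log_exp _
  have h1 : ∀ i, pr η β i * (- Real.log (if i ∈ G then (2 * (2 * κ * T))⁻¹ else (2 * T)⁻¹)) =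
      pr η β i * (Real.log 2 + (N + W) * hh) + (if i ∈ G then pr η β i * Real.log (2 * κ) else 0) := by
    intro i
    split_ifs
    · rw [Real.log_inv, Real.log_mul two_ne_zero (by positivity),
        Real.log_mul (by positivity) hTpos.ne', hlogT]
      ring
    · rw [Real.log_inv, Real.log_mul two_ne_zero hTpos.ne', hlogT]
      ring
  rw [Finset.sum_congr rfl fun i _ => h1 i, Finset.sum_add_distrib, ← Finset.sum_mul, sum_pr η hβ,
    Finset.sum_ite_mem, Finset.univ_inter, ← Finset.sum_mul]
  nlinarith

end Gap

section Fiber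

variable {X : Type*} [MetricSpace X] [CompactSpace X]

lemma semi_iter {f g h : X → X} (hsemi : ∀ x : X, f (h x) = h (g x)) (j : ℕ) (x : X) :
    h (g^[j] x) = f^[j] (h x) :=
  (Function.Semiconj.iterate_right (f := h) (ga := g) (gb := f) (fun x => (hsemi x).symm) j) x

lemma fiber_local [Nonempty X] {g h : X → X} (hg : Continuous g) (hcont : Continuous h)
    (hsurj : Function.Surjective h) (H1 : HypH1 g h) {ε δ : ℝ} (hε : 0 < ε) (hδ : 0 < δ) (y : X) :
    ∃ m : ℕ, 1 ≤ m ∧ ∃ E : Finset X, (E.card : ℝ) ≤ Real.exp (δ * m) ∧ ∃ V : Set X, IsOpen V ∧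
      y ∈ V ∧ ∀ x, h x ∈ V → ∃ e ∈ E, ∀ j < m, dist (g^[j] x) (g^[j] e) < 2 * ε := by
  classical
  obtain ⟨x0, rfl⟩ := hsurj y
  set K := h ⁻¹' {h x0} with hK
  have hlim : Filter.limsup (fun n : ℕ => ENNReal.log (sepCard g K n ε) / (n : EReal)) atTop
      < (δ : EReal) := by
    refine lt_of_le_of_lt ?_ (show (0 : EReal) < δ by exact_mod_cast hδ)
    rw [← H1 x0]
    exact le_iSup₂ (f := fun (ε : ℝ) (_ : 0 < ε) =>
      Filter.limsup (fun n : ℕ => ENNReal.log (sepCard g K n ε) / (n : EReal)) atTop) ε hε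
  obtain ⟨m, hm, hm1⟩ := ((Filter.eventually_lt_of_limsup_lt hlim).and
    (eventually_ge_atTop 1)).exists
  rw [EReal.div_lt_iff (by exact_mod_cast hm1) (EReal.natCast_ne_top _)] at hm
  have hcard : ∀ E : Finset X, ↑E ⊆ K → IsSep g m ε ↑E → (E.card : ℝ) ≤ Real.exp (δ * m) := by
    intro E hEK hE
    rcases Nat.eq_zero_or_pos E.card with h0 | h0
    · rw [h0]; simpa using (Real.exp_pos _).le
    have h1 : (E.card : ℝ≥0∞) ≤ sepCard g K m ε :=
      le_iSup₂ (f := fun (E : Finset X) (_ : ↑E ⊆ K ∧ IsSep g m ε ↑E) => (E.card : ℝ≥0∞))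
        E ⟨hEK, hE⟩
    have h2 := (ENNReal.log_monotone h1).trans_lt hm
    have h0' : (0 : ℝ) < E.card := by exact_mod_cast h0
    rw [← ENNReal.ofReal_natCast, ENNReal.log_ofReal_of_pos h0'] at h2
    have h3 : Real.log E.card < δ * m := by exact_mod_cast h2
    exact ((Real.log_lt_iff_lt_exp h0').1 h3).le
  have hbdd : BddAbove {k | ∃ E : Finset X, (↑E ⊆ K ∧ IsSep g m ε ↑E) ∧ E.card = k} := by
    refine ⟨rn g ε m, ?_⟩
    rintro k ⟨E, hE, rfl⟩
    exact le_rn g hε m E hE.2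
  obtain ⟨E, ⟨hEK, hE⟩, hEc⟩ := Nat.sSup_mem
    (s := {k | ∃ E : Finset X, (↑E ⊆ K ∧ IsSep g m ε ↑E) ∧ E.card = k})
    ⟨0, ∅, by simp [IsSep], rfl⟩ hbdd
  have hspan := spanning hε.le hEK hE (fun E' h1 h2 => by
    rw [hEc]; exact le_csSup hbdd ⟨E', ⟨h1, h2⟩, rfl⟩)
  refine ⟨m, hm1, E, hcard E hEK hE, ?_⟩
  let U : Set X := ⋃ e ∈ E, ⋂ j ∈ Finset.range m, {x | dist (g^[j] x) (g^[j] e) < 2 * ε}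
  have hU : IsOpen U := by
    refine isOpen_biUnion fun e _ => isOpen_biInter_finset fun j _ => ?_
    exact isOpen_lt ((hg.iterate j).dist continuous_const) continuous_const
  have hUmem : ∀ x, x ∈ U ↔ ∃ e ∈ E, ∀ j < m, dist (g^[j] x) (g^[j] e) < 2 * ε := by
    intro x; simp [U]
  refine ⟨(h '' Uᶜ)ᶜ, (hcont.isClosedMap _ hU.isClosed_compl).isOpen_compl, ?_, ?_⟩
  · rintro ⟨x, hx, hxy⟩
    refine hx ((hUmem x).2 ?_)
    obtain ⟨e, he, hb⟩ := hspan x hxy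
    exact ⟨e, he, fun j hj => (hb j hj).trans_lt (by linarith)⟩
  · intro x hx
    rw [← hUmem]
    by_contra hxU
    exact hx ⟨x, hxU, rfl⟩

lemma bowen_count [Nonempty X] {f g h : X → X} (hg : Continuous g) (hcont : Continuous h)
    (hsurj : Function.Surjective h) (hsemi : ∀ x : X, f (h x) = h (g x)) (H1 : HypH1 g h)
    {ε δ : ℝ} (hε : 0 < ε) (hδ : 0 < δ) :
    ∃ lam > 0, ∃ mm : ℕ, ∀ (n : ℕ) (D : Set X) (y : X),
      (∀ x ∈ D, ∀ j < n, dist (f^[j] (h x)) (f^[j] y) < lam) →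
      ∃ (T : Finset (List X)) (c : X → List X), (T.card : ℝ) ≤ Real.exp (δ * (n + mm)) ∧
        (∀ x ∈ D, c x ∈ T) ∧
        ∀ x ∈ D, ∀ x' ∈ D, c x = c x' → ∀ j < n, dist (g^[j] x) (g^[j] x') < 4 * ε := by
  classical
  choose m hm1 E hE V hV hyV hcov using fiber_local hg hcont hsurj H1 hε hδ
  obtain ⟨t, ht⟩ := isCompact_univ.elim_finite_subcover V hV (fun y _ => mem_iUnion.2 ⟨y, hyV y⟩)
  obtain ⟨lam, hlam, hleb⟩ := lebesgue_number_lemma_of_metric (c := fun i : t => V i)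
    isCompact_univ (fun i => hV i) (fun x hx => by
      have := ht hx
      simp only [mem_iUnion, exists_prop] at this
      obtain ⟨i, hi, hx⟩ := this
      exact mem_iUnion.2 ⟨⟨i, hi⟩, hx⟩)
  refine ⟨lam, hlam, t.sup m, fun n => ?_⟩
  induction n using Nat.strong_induction_on with
  | _ n ih =>
  intro D y hD
  rcases Nat.eq_zero_or_pos n with rfl | hn
  · refine ⟨{[]}, fun _ => [], ?_, by simp, by simp⟩
    simp only [Finset.card_singleton, Nat.cast_one]
    exact Real.one_le_exp (by positivity)
  obtain ⟨i, hi⟩ := hleb y (mem_univ y)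
  have hmi : m i ≤ t.sup m := Finset.le_sup i.2
  have hex : ∀ x, ∃ e, x ∈ D → e ∈ E i ∧ ∀ j < m i, dist (g^[j] x) (g^[j] e) < 2 * ε := by
    intro x
    by_cases hx : x ∈ D
    · obtain ⟨e, he1, he2⟩ := hcov i x (hi (by simpa using hD x hx 0 hn))
      exact ⟨e, fun _ => ⟨he1, he2⟩⟩
    · exact ⟨x, fun h => absurd h hx⟩
  choose e he using hex
  have hcl : ∀ x ∈ D, ∀ x' ∈ D, e x = e x' → ∀ j < m i, dist (g^[j] x) (g^[j] x') < 4 * ε := by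
    intro x hx x' hx' hee j hj
    have h1 := (he x hx).2 j hj
    have h2 := (he x' hx').2 j hj
    rw [← hee, dist_comm] at h2
    linarith [dist_triangle (g^[j] x) (g^[j] (e x)) (g^[j] x')]
  rcases le_or_gt n (m i) with hnm | hnm
  · refine ⟨(E i).image (fun a => [a]), fun x => [e x], ?_, ?_, ?_⟩
    · have h1 : (((E i).image (fun a => [a])).card : ℝ) ≤ (E i).card := by
        exact_mod_cast Finset.card_image_le
      refine h1.trans ((hE i).trans (Real.exp_le_exp.2 ?_))
      have : (m i : ℝ) ≤ (t.sup m : ℕ) := by exact_mod_cast hmi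
      have hn0 : (0 : ℝ) ≤ n := by positivity
      nlinarith
    · intro x hx
      exact Finset.mem_image.2 ⟨e x, (he x hx).1, rfl⟩
    · intro x hx x' hx' hcc j hj
      exact hcl x hx x' hx' (by simpa using hcc) j (by omega)
  · have hmi1 := hm1 i
    obtain ⟨T, c, hT, hcT, hc⟩ := ih (n - m i) (by omega) (g^[m i] '' D) (f^[m i] y) (by
      rintro _ ⟨x, hx, rfl⟩ j hj
      rw [semi_iter hsemi, ← Function.iterate_add_apply, ← Function.iterate_add_apply]
      exact hD x hx _ (by omega))
    refine ⟨Finset.image₂ (fun a l => a :: l) (E i) T, fun x => e x :: c (g^[m i] x), ?_, ?_, ?_⟩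
    · have h1 : ((Finset.image₂ (fun a l => a :: l) (E i) T).card : ℝ) ≤ (E i).card * T.card := by
        have := Finset.card_image₂_le (fun (a : X) (l : List X) => a :: l) (E i) T
        exact_mod_cast this
      refine h1.trans ?_
      calc ((E i).card : ℝ) * T.card
          ≤ Real.exp (δ * m i) * Real.exp (δ * ((n - m i : ℕ) + (t.sup m : ℕ))) := by
            gcongr
            exact hE i
        _ = Real.exp (δ * (n + (t.sup m : ℕ))) := by
            rw [← Real.exp_add, Nat.cast_sub hnm.le]
            congr 1; ring
    · intro x hx
      exact Finset.mem_image₂.2 ⟨e x, (he x hx).1, _, hcT _ ⟨x, hx, rfl⟩, rfl⟩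
    · intro x hx x' hx' hcc j hj
      simp only [List.cons.injEq] at hcc
      rcases lt_or_ge j (m i) with hjm | hjm
      · exact hcl x hx x' hx' hcc.1 j hjm
      · have := hc _ ⟨x, hx, rfl⟩ _ ⟨x', hx', rfl⟩ hcc.2 (j - m i) (by omega)
        rw [← Function.iterate_add_apply, ← Function.iterate_add_apply,
          Nat.sub_add_cancel hjm] at this
        exact this

end Fiber

section PartR

variable {X : Type*} [MetricSpace X] [CompactSpace X] [MeasurableSpace X] [BorelSpace X]

lemma R_exists (η : Measure X) [IsProbabilityMeasure η] {P : Finset (Set X)} (hP : IsMPartition P)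
    {δ : ℝ} (hδ : 0 < δ) :
    ∃ (cell : X → ↥P) (R : X → Option ↥P) (ε : ℝ), 0 < ε ∧ MF cell ∧
      (∀ x A, cell x = A ↔ x ∈ A.1) ∧ MF R ∧ Hf η R ≤ δ ∧
      ∀ x x', R x = R x' → dist x x' < 4 * ε → cell x = cell x' := by
  classical
  obtain ⟨hPm, hPd, hPc⟩ := hP
  have hex : ∀ x : X, ∃ A : ↥P, x ∈ A.1 := by
    intro x
    have : x ∈ ⋃₀ (P : Set (Set X)) := by rw [hPc]; trivial
    obtain ⟨A, hA, hx⟩ := this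
    exact ⟨⟨A, hA⟩, hx⟩
  choose cell hcell using hex
  have hiff : ∀ x A, cell x = A ↔ x ∈ A.1 := by
    intro x A
    constructor
    · rintro rfl; exact hcell x
    · intro hx
      by_contra hne
      have := hPd (cell x).2 A.2 (fun h => hne (Subtype.ext h))
      exact Set.disjoint_left.1 this (hcell x) hx
  have hpre : ∀ A : ↥P, cell ⁻¹' {A} = A.1 := by
    intro A; ext x; simp [hiff]
  have hMF : MF cell := fun A => by rw [hpre]; exact hPm _ A.2
  set d := δ / (Fintype.card ↥P + 1) with hd
  have hdpos : 0 < d := by positivity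
  have hc0 := Real.continuous_negMulLog.tendsto 0
  have hc1 := Real.continuous_negMulLog.tendsto 1
  rw [Metric.tendsto_nhds_nhds] at hc0 hc1
  obtain ⟨κ1, hκ1, h0⟩ := hc0 d hdpos
  obtain ⟨κ2, hκ2, h1⟩ := hc1 d hdpos
  set κ := min κ1 (κ2 / (Fintype.card ↥P + 1)) with hκ
  have hκpos : 0 < κ := lt_min hκ1 (by positivity)
  have hC : ∀ A : ↥P, ∃ C ⊆ A.1, IsCompact C ∧ η (A.1 \ C) < ENNReal.ofReal κ := by
    intro A
    exact (hPm _ A.2).exists_isCompact_sdiff_lt (measure_ne_top _ _)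
      (by simpa using hκpos)
  choose C hCA hCc hCη using hC
  set R : X → Option ↥P := fun x => if x ∈ C (cell x) then none else some (cell x) with hR
  have hRs : ∀ A, R ⁻¹' {some A} = A.1 \ C A := by
    intro A; ext x
    simp only [hR, mem_preimage, mem_singleton_iff, Set.mem_sdiff]
    constructor
    · intro hx
      split_ifs at hx with h
      rw [Option.some_inj] at hx
      subst hx
      exact ⟨hcell x, h⟩
    · rintro ⟨hx, hn⟩
      have := (hiff x A).2 hx
      rw [this, if_neg hn]
  have hRn : R ⁻¹' {none} = ⋃ A, C A := by
    ext x
    simp only [hR, mem_preimage, mem_singleton_iff, mem_iUnion]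
    constructor
    · intro hx
      split_ifs at hx with h
      exact ⟨_, h⟩
    · rintro ⟨A, hx⟩
      have := (hiff x A).2 (hCA A hx)
      rw [this, if_pos hx]
  have hRMF : MF R := by
    rintro (_ | A)
    · rw [hRn]; exact MeasurableSet.iUnion fun A => (hCc A).measurableSet
    · rw [hRs]; exact (hPm _ A.2).diff (hCc A).measurableSet
  have hprs : ∀ A, pr η R (some A) < κ := by
    intro A
    unfold pr
    rw [hRs]
    have := hCη A
    rwa [ENNReal.lt_ofReal_iff_toReal_lt (measure_ne_top _ _)] at this
  have hsum := sum_pr η hRMF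
  rw [Fintype.sum_option] at hsum
  have hH : Hf η R ≤ δ := by
    unfold Hf
    rw [Fintype.sum_option]
    have e1 : ∀ A, Real.negMulLog (pr η R (some A)) ≤ d := by
      intro A
      have := h0 (x := pr η R (some A)) (by
        rw [Real.dist_eq, sub_zero, abs_of_nonneg (pr_nonneg _ _ _)]
        exact (hprs A).trans_le (min_le_left _ _))
      rw [Real.negMulLog_zero, Real.dist_eq, sub_zero] at this
      exact (le_abs_self _).trans this.le
    have e2 : ∑ A, pr η R (some A) ≤ Fintype.card ↥P * κ := by
      refine (Finset.sum_le_sum fun A _ => (hprs A).le).trans ?_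
      simp
    have e3 : ∑ A, pr η R (some A) < κ2 := by
      have : κ * (Fintype.card ↥P + 1) ≤ κ2 := by
        rw [← le_div_iff₀ (by positivity)]; exact min_le_right _ _
      nlinarith
    have e4 : 0 ≤ ∑ A, pr η R (some A) := Finset.sum_nonneg fun A _ => pr_nonneg _ _ _
    have e5 : Real.negMulLog (pr η R none) ≤ d := by
      have := h1 (x := pr η R none) (by
        rw [Real.dist_eq, abs_lt]
        constructor <;> linarith)
      rw [Real.negMulLog_one, Real.dist_eq, sub_zero] at this
      exact (le_abs_self _).trans this.le
    have e6 : ∑ A, Real.negMulLog (pr η R (some A)) ≤ Fintype.card ↥P * d := by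
      refine (Finset.sum_le_sum fun A _ => e1 A).trans ?_
      simp
    have e7 : d * (Fintype.card ↥P + 1) = δ := by rw [hd]; field_simp
    linarith
  have hsep : ∀ p : ↥P × ↥P, ∀ᶠ ε in 𝓝[>] (0 : ℝ), p.1 ≠ p.2 →
      ∀ x ∈ C p.1, ∀ y ∈ C p.2, 4 * ε ≤ dist x y := by
    rintro ⟨A, B⟩
    by_cases hAB : A = B
    · simp [hAB]
    have hdis : Disjoint (C A) (C B) := by
      have := hPd A.2 B.2 (fun h => hAB (Subtype.ext h))
      exact Disjoint.mono (hCA A) (hCA B) this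
    obtain ⟨r, hr, hrd⟩ := Metric.exists_pos_forall_lt_edist (hCc A) (hCc B).isClosed hdis
    have hr4 : (0 : ℝ) < r / 4 := by have : (0 : ℝ) < r := hr
                                     positivity
    filter_upwards [Ioo_mem_nhdsGT hr4] with ε hε _ x hx y hy
    have := hrd x hx y hy
    rw [edist_nndist] at this
    have h2 : r < nndist x y := by exact_mod_cast this
    have h3 : (r : ℝ) < dist x y := by exact_mod_cast h2
    have := hε.2
    linarith
  have hsep' := (eventually_all.2 hsep).and self_mem_nhdsWithin
  obtain ⟨ε, hε, hε0⟩ := hsep'.exists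
  refine ⟨cell, R, ε, hε0, hMF, hiff, hRMF, hH, fun x x' hxx hdist => ?_⟩
  by_contra hne
  simp only [hR] at hxx
  split_ifs at hxx with a b
  · exact absurd (hε (cell x, cell x') hne x a x' b) (not_le.2 hdist)
  · exact hne (Option.some_inj.1 hxx)

end PartR

section MainBound

variable {X : Type*} [MetricSpace X] [CompactSpace X] [MeasurableSpace X] [BorelSpace X]

lemma map_iterate_eq {η : Measure X} {g : X → X} (hg : Measurable g) (hinv : Measure.map g η = η)
    (s : ℕ) : Measure.map (g^[s]) η = η :=
  (MeasurePreserving.iterate ⟨hg, hinv⟩ s).map_eq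

lemma dynH_eq (η : Measure X) (g : X → X) {P : Finset (Set X)} {cell : X → ↥P}
    (hcell : ∀ x A, cell x = A ↔ x ∈ A.1) (n : ℕ) :
    dynH η g P n = Hf η (fun x (j : Fin n) => cell (g^[j.1] x)) := by
  unfold dynH Hf pr Measure.real
  refine Finset.sum_congr rfl fun A _ => ?_
  congr 3
  ext x
  simp [funext_iff, hcell]

lemma main_bound [Nonempty X] {f g : X ≃ₜ X} {h : X → X} (hcont : Continuous h)
    (hsurj : Function.Surjective h) (hsemi : ∀ x : X, f (h x) = h (g x)) {α : ℝ}
    (hα : IsExpansiveWith f α) (H1 : HypH1 (⇑g) h)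
    (η : Measure X) [IsProbabilityMeasure η] (hinv : Measure.map (⇑g) η = η)
    {N : ℕ} (hN : 1 ≤ N) {k : ℕ} {β : X → Fin k} (hβ : MF (fun x => β (h x)))
    (hβd : ∀ x y, β x = β y → ∀ j < N, dist (f^[j] x) (f^[j] y) ≤ α)
    {P : Finset (Set X)} (hP : IsMPartition P) {δ : ℝ} (hδ : 0 < δ) :
    ⨅ n : ℕ, ((dynH η g P (n + 1) / (n + 1) : ℝ) : EReal) ≤
      ((Hf η (fun x => β (h x)) / N + 3 * δ : ℝ) : EReal) := by
  classical
  obtain ⟨cell, R, ε, hε, hcM, hcell, hRM, hRH, hRc⟩ := R_exists η hP hδ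
  obtain ⟨lam, hlam, mm, hcount⟩ :=
    bowen_count (f := f) g.continuous hcont hsurj hsemi H1 hε hδ
  obtain ⟨L, hL⟩ := unif_exp hα hlam
  set Hb := Hf η (fun x => β (h x)) with hHb
  have hHb0 : 0 ≤ Hb := Hf_nonneg _ _
  obtain ⟨m, hm⟩ := exists_nat_ge (max 1 ((2 * L * Hb + δ * mm) / δ))
  have hm1 : 1 ≤ m := by exact_mod_cast (le_max_left _ _).trans hm
  have hm2 : 2 * L * Hb + δ * mm ≤ δ * m := by
    have := (le_max_right _ _).trans hm
    rw [div_le_iff₀ hδ] at this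
    linarith
  set n := m * N with hn
  set s := L * N with hs
  have hLs : L ≤ s := Nat.le_mul_of_pos_right _ hN
  have hgm : ∀ t, Measurable (g^[t]) := fun t => (g.continuous.iterate t).measurable
  have hginv : ∀ t, Measure.map (g^[t]) η = η :=
    map_iterate_eq g.continuous.measurable hinv
  have compMF : ∀ {ι : Type _} {φ : X → ι} (_ : MF φ) (t : ℕ), MF (fun x => φ (g^[t] x)) :=
    fun hφ t i => hgm t (hφ i)
  set Φ : X → (Fin n → ↥P) := fun x j => cell (g^[j.1] (g^[s] x)) with hΦ
  set Ψa : X → (Fin n → Option ↥P) := fun x j => R (g^[j.1] (g^[s] x)) with hΨa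
  set Ψb : X → (Fin (m + 2 * L) → Fin k) := fun x i => β (h (g^[i.1 * N] x)) with hΨb
  have hΦM : MF Φ := MF.pi (φ := fun (j : Fin n) x => cell (g^[j.1] (g^[s] x))) fun j =>
    compMF (compMF hcM j.1) s
  have hΨaM' : ∀ j : Fin n, MF (fun x => R (g^[j.1] (g^[s] x))) := fun j =>
    compMF (compMF hRM j.1) s
  have hΨaM : MF Ψa := MF.pi (φ := fun (j : Fin n) x => R (g^[j.1] (g^[s] x))) hΨaM'
  have hΨbM' : ∀ i : Fin (m + 2 * L), MF (fun x => β (h (g^[i.1 * N] x))) := fun i b =>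
    hgm (i.1 * N) (hβ b)
  have hΨbM : MF Ψb :=
    MF.pi (φ := fun (i : Fin (m + 2 * L)) x => β (h (g^[i.1 * N] x))) hΨbM'
  have hΨM := hΨaM.prodMk hΨbM
  have e0 : dynH η g P n = Hf η Φ := by
    rw [dynH_eq η g hcell n]
    exact (Hf_inv η (hgm s) (hginv s)
      (MF.pi (φ := fun (j : Fin n) x => cell (g^[j.1] x)) fun j => compMF hcM j.1)).symm
  have e1 : Hf η Φ ≤ Hf η (fun x => (Φ x, (Ψa x, Ψb x))) :=
    Hf_comp_le η (hΦM.prodMk hΨM) Prod.fst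
  have e2 : Hf η (fun x => (Φ x, (Ψa x, Ψb x))) ≤
      Hf η (fun x => (Ψa x, Ψb x)) + Real.log (Real.exp (δ * (n + mm))) := by
    refine Hf_pair_count η hΦM hΨM _ (Real.exp_pos _) fun b => ?_
    by_cases hb : ∃ x0, (Ψa x0, Ψb x0) = b
    swap
    · push Not at hb
      rw [Finset.card_eq_zero.2]
      · simpa using (Real.exp_pos _).le
      · refine Finset.filter_eq_empty_iff.2 ?_
        rintro a _ ⟨x, _, hx⟩
        exact hb x hx
    obtain ⟨x0, hx0⟩ := hb
    have key : ∀ x' ∈ g^[s] '' {x | (Ψa x, Ψb x) = b}, ∀ j < n,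
        dist (f^[j] (h x')) (f^[j] (f^[s] (h x0))) < lam := by
      rintro _ ⟨x, hx, rfl⟩ j hj
      have hx : (Ψa x, Ψb x) = b := hx
      have hΨ : Ψb x = Ψb x0 := by
        rw [← hx0] at hx
        exact (Prod.mk.inj hx).2
      rw [semi_iter (f := f) hsemi, ← Function.iterate_add_apply, ← Function.iterate_add_apply]
      have hjs : j + s = L + (j + s - L) := by omega
      rw [hjs, Function.iterate_add_apply, Function.iterate_add_apply]
      refine hL _ _ fun t ht => ?_
      rw [← Function.iterate_add_apply, ← Function.iterate_add_apply]
      set τ := t + (j + s - L) with hτ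
      have hτlt : τ < (m + 2 * L) * N := by
        have : (m + 2 * L) * N = n + 2 * s := by rw [hn, hs]; ring
        omega
      have hi : τ / N < m + 2 * L := (Nat.div_lt_iff_lt_mul hN).2 hτlt
      have h1 := congrFun hΨ ⟨τ / N, hi⟩
      simp only [hΨb] at h1
      rw [semi_iter (f := f) hsemi, semi_iter (f := f) hsemi] at h1
      have h2 := hβd _ _ h1 (τ % N) (Nat.mod_lt _ hN)
      rw [← Function.iterate_add_apply, ← Function.iterate_add_apply,
        Nat.mod_add_div'] at h2
      exact h2
    obtain ⟨T, c, hTc, hcT, hcd⟩ := hcount n _ _ key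
    refine le_trans ?_ hTc
    have hch : ∀ a : Fin n → ↥P, ∃ x, (∃ x, Φ x = a ∧ (Ψa x, Ψb x) = b) →
        Φ x = a ∧ (Ψa x, Ψb x) = b := by
      intro a
      by_cases ha : ∃ x, Φ x = a ∧ (Ψa x, Ψb x) = b
      · obtain ⟨x, hx⟩ := ha; exact ⟨x, fun _ => hx⟩
      · exact ⟨x0, fun h => absurd h ha⟩
    choose w hw using hch
    have hcard := Finset.card_le_card_of_injOn
      (s := Finset.univ.filter fun a => ∃ x, Φ x = a ∧ (Ψa x, Ψb x) = b) (t := T)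
      (fun a => c (g^[s] (w a))) (by
        intro a ha
        have ha' := (Finset.mem_filter.1 ha).2
        exact hcT _ ⟨w a, (hw a ha').2, rfl⟩) (by
        intro a ha a' ha' haa
        have ha := hw a (Finset.mem_filter.1 ha).2
        have ha' := hw a' (Finset.mem_filter.1 ha').2
        have hd := hcd _ ⟨w a, ha.2, rfl⟩ _ ⟨w a', ha'.2, rfl⟩ haa
        rw [← ha.1, ← ha'.1]
        funext j
        refine hRc _ _ ?_ (hd j.1 j.2)
        have h3 := ha.2.trans ha'.2.symm
        exact congrFun (Prod.mk.inj h3).1 j)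
    exact_mod_cast hcard
  rw [Real.log_exp] at e2
  have e3 : Hf η (fun x => (Ψa x, Ψb x)) ≤ Hf η Ψa + Hf η Ψb := Hf_pair_le η hΨaM hΨbM
  have e4 : Hf η Ψa ≤ n * δ := by
    refine (Hf_pi_le η hΨaM').trans ?_
    have : ∀ j : Fin n, Hf η (fun x => R (g^[j.1] (g^[s] x))) ≤ δ := by
      intro j
      have h1 := Hf_inv η (hgm s) (hginv s) (compMF hRM j.1)
      have h2 := Hf_inv η (hgm j.1) (hginv j.1) hRM
      rw [h1, h2]; exact hRH
    refine (Finset.sum_le_sum fun j _ => this j).trans ?_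
    simp
  have e5 : Hf η Ψb ≤ (m + 2 * L) * Hb := by
    refine (Hf_pi_le η hΨbM').trans ?_
    have : ∀ i : Fin (m + 2 * L), Hf η (fun x => β (h (g^[i.1 * N] x))) ≤ Hb := by
      intro i
      exact (Hf_inv η (hgm (i.1 * N)) (hginv (i.1 * N)) hβ).le
    refine (Finset.sum_le_sum fun j _ => this j).trans ?_
    simp
  have hnpos : 1 ≤ n := Nat.mul_pos hm1 hN
  have hNr : (1 : ℝ) ≤ N := by exact_mod_cast hN
  have hmr : (1 : ℝ) ≤ m := by exact_mod_cast hm1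
  have hnr : (n : ℝ) = m * N := by rw [hn]; push_cast; ring
  have e6 : dynH η g P n / n ≤ Hb / N + 3 * δ := by
    rw [div_le_iff₀ (by exact_mod_cast hnpos)]
    have h1 : (Hb / N + 3 * δ) * n = m * Hb + 3 * δ * n := by
      rw [hnr]; field_simp
    rw [h1]
    have h2 : δ * m ≤ δ * n := by
      rw [hnr]; refine mul_le_mul_of_nonneg_left ?_ hδ.le; nlinarith
    linarith
  obtain ⟨n', hn'⟩ : ∃ n', n = n' + 1 := ⟨n - 1, by omega⟩
  refine (iInf_le _ n').trans ?_
  rw [EReal.coe_le_coe_iff]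
  rw [hn'] at e6
  push_cast at e6
  exact e6

end MainBound

section Sing

variable {X : Type*} [MetricSpace X] [CompactSpace X] [MeasurableSpace X] [BorelSpace X]

lemma nu_map {f : X ≃ₜ X} {g h : X → X} (hcont : Continuous h) {α : ℝ}
    (hα : IsExpansiveWith f α) {μ : Measure X}
    [IsProbabilityMeasure μ] (hμ : WeakLimit (perMeasure (⇑f)) μ)
    {P : ℕ → Set X} (hP : IsPerSelection (⇑f) g h P)
    {ν : Measure X} (hν : WeakClusterPt (fun n => unifMeasure (P n)) ν) :
    Measure.map h ν = μ := by
  classical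
  obtain ⟨u, hu, hlim⟩ := hν
  have key : ∀ φ : C(X, ℝ), ∫ x, φ (h x) ∂ν = ∫ x, φ x ∂μ := by
    intro φ
    have h1 := hlim ⟨fun x => φ (h x), φ.continuous.comp hcont⟩
    have h2 := (hμ φ).comp hu.tendsto_atTop
    refine tendsto_nhds_unique h1 (h2.congr' ?_)
    filter_upwards [hu.tendsto_atTop.eventually (eventually_ge_atTop 1)] with n hn
    obtain ⟨-, -, hb⟩ := hP (u n)
    have hfin := per_finite hα hn
    have hPfin : (P (u n)).Finite := Set.Finite.of_finite_image (hb.image_eq ▸ hfin) hb.injOn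
    have e1 : P (u n) = ↑hPfin.toFinset := by simp
    have e2 : perSet f (u n) = ↑hfin.toFinset := by simp
    simp only [Function.comp, perMeasure, unifMeasure, ContinuousMap.coe_mk]
    have h3 : hfin.toFinset = hPfin.toFinset.image h := by
      ext y
      simp only [Set.Finite.mem_toFinset, Finset.mem_image]
      rw [← hb.image_eq]; rfl
    have hinj : Set.InjOn h hPfin.toFinset := by rw [← e1]; exact hb.injOn
    rw [e1, e2, integral_unif, integral_unif, h3, Finset.sum_image hinj,
      Finset.card_image_of_injOn hinj]
  have hfinν : IsFiniteMeasure ν := by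
    have h1 := key 1
    simp only [ContinuousMap.one_apply, integral_const, smul_eq_mul, mul_one] at h1
    have h2 : μ.real univ = 1 := by simp
    rw [h2] at h1
    refine ⟨lt_top_iff_ne_top.2 fun ht => ?_⟩
    rw [Measure.real, ht] at h1
    simp at h1
  have := Measure.isFiniteMeasure_map ν h
  refine measure_eq_of_integral fun φ => ?_
  rw [integral_map hcont.measurable.aemeasurable φ.continuous.aestronglyMeasurable]
  exact key φ

lemma triv_meas {h : X → X} (hcont : Continuous h) (hsurj : Function.Surjective h) :
    MeasurableSet {y : X | ∃ x : X, h ⁻¹' {y} = {x}} := by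
  rw [← MeasurableSet.compl_iff]
  have : {y : X | ∃ x : X, h ⁻¹' {y} = {x}}ᶜ = ⋃ n : ℕ,
      (fun p : X × X => h p.1) '' {p | h p.1 = h p.2 ∧ (1 / (n + 1) : ℝ) ≤ dist p.1 p.2} := by
    ext y
    simp only [mem_compl_iff, mem_ofPred_eq, mem_iUnion, Set.mem_image, Prod.exists]
    constructor
    · intro hy
      obtain ⟨x, rfl⟩ := hsurj y
      have : ∃ x', h x' = h x ∧ x' ≠ x := by
        by_contra! hcon
        exact hy ⟨x, by ext z; simpa using ⟨hcon z, fun e => e ▸ rfl⟩⟩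
      obtain ⟨x', h1, h2⟩ := this
      obtain ⟨n, hn⟩ := exists_nat_one_div_lt (dist_pos.2 h2.symm)
      exact ⟨n, x, x', ⟨h1.symm, hn.le⟩, rfl⟩
    · rintro ⟨n, x, x', ⟨h1, h2⟩, rfl⟩ ⟨z, hz⟩
      have hx : x ∈ h ⁻¹' {h x} := rfl
      have hx' : x' ∈ h ⁻¹' {h x} := h1.symm
      rw [hz] at hx hx'
      rw [mem_singleton_iff] at hx hx'
      rw [hx, hx', dist_self] at h2
      have : (0 : ℝ) < 1 / (n + 1) := by positivity
      linarith
  rw [this]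
  refine MeasurableSet.iUnion fun n => IsCompact.measurableSet ?_
  refine IsCompact.image ?_ (hcont.comp continuous_fst)
  refine IsClosed.isCompact ?_
  exact (isClosed_eq (hcont.comp continuous_fst) (hcont.comp continuous_snd)).inter
    (isClosed_le continuous_const continuous_dist)

lemma small_sets {h : X → X} (hcont : Continuous h) (hsurj : Function.Surjective h)
    {μ ν η : Measure X} [IsProbabilityMeasure μ] [IsProbabilityMeasure η]
    (hνμ : Measure.map h ν = μ) (H3 : HypH3 h μ) (hsing : η ⟂ₘ ν) {κ : ℝ} (hκ : 0 < κ) :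
    ∃ K : Set X, IsCompact K ∧ 1 - κ ≤ (Measure.map h η).real K ∧
      ∃ U, IsOpen U ∧ K ⊆ U ∧ μ.real U ≤ κ := by
  obtain ⟨S, hS, hηS, hνS⟩ := hsing
  obtain ⟨C, hCS, hC, hCη⟩ := hS.compl.exists_isCompact_sdiff_lt (μ := η) (measure_ne_top _ _)
    (ε := ENNReal.ofReal κ) (by simpa using hκ)
  have hK : IsCompact (h '' C) := hC.image hcont
  have hT := triv_meas hcont hsurj
  have hTc : μ {y : X | ∃ x : X, h ⁻¹' {y} = {x}}ᶜ = 0 := by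
    rw [prob_compl_eq_zero_iff hT]; exact H3
  have hμK : μ (h '' C) = 0 := by
    have hsub : h ⁻¹' (h '' C) ⊆ Sᶜ ∪ h ⁻¹' {y : X | ∃ x : X, h ⁻¹' {y} = {x}}ᶜ := by
      rintro x ⟨c, hc, hcx⟩
      by_cases ht : ∃ z : X, h ⁻¹' {h x} = {z}
      · left
        obtain ⟨z, hz⟩ := ht
        have h1 : x ∈ h ⁻¹' {h x} := rfl
        have h2 : c ∈ h ⁻¹' {h x} := hcx
        rw [hz, mem_singleton_iff] at h1 h2
        rw [h1, ← h2]; exact hCS hc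
      · right; exact ht
    rw [← hνμ, Measure.map_apply hcont.measurable hK.measurableSet]
    refine measure_mono_null hsub (measure_union_null hνS ?_)
    rw [← hνμ, Measure.map_apply hcont.measurable hT.compl] at hTc
    exact hTc
  refine ⟨h '' C, hK, ?_, ?_⟩
  · rw [map_measureReal_apply hcont.measurable hK.measurableSet]
    have h1 : η.real C ≤ η.real (h ⁻¹' (h '' C)) := measureReal_mono (subset_preimage_image h C)
    have h2 : η.real (Sᶜ \ C) < κ := by
      rwa [ENNReal.lt_ofReal_iff_toReal_lt (measure_ne_top _ _)] at hCη
    have h3 : η.real (Sᶜ \ C) = η.real Sᶜ - η.real C := measureReal_sdiff hCS hC.measurableSet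
    have h4 : η.real Sᶜ = 1 - η.real S := probReal_compl_eq_one_sub hS
    have h5 : η.real S = 0 := by rw [Measure.real, hηS]; rfl
    linarith
  · obtain ⟨U, hKU, hU, hμU⟩ := (h '' C).exists_isOpen_lt_of_lt (μ := μ) (ENNReal.ofReal κ) (by
      rw [hμK]; simpa using hκ)
    refine ⟨U, hU, hKU, ?_⟩
    rw [ENNReal.lt_ofReal_iff_toReal_lt (measure_ne_top _ _)] at hμU
    exact hμU.le

end Sing

end SamvaAux

/-- Under (H1), (H2), (H3), any `g`-invariant probability measure `η` singular with respect
to the accumulation point `ν` of `(ν_n)` has entropy strictly less than `h_top(g)`. -/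
theorem singular_measure_entropy_lt
    {X : Type*} [MetricSpace X] [CompactSpace X] [MeasurableSpace X] [BorelSpace X]
    (f g : X ≃ₜ X) (h : X → X) (hcont : Continuous h) (hsurj : Function.Surjective h)
    (hsemi : ∀ x : X, f (h x) = h (g x))
    (hexp : IsExpansive f) (hspec : HasSpecification f)
    (μ : Measure X) (hμprob : IsProbabilityMeasure μ)
    (hμ : WeakLimit (perMeasure (⇑f)) μ)
    (H1 : HypH1 (⇑g) h) (H2 : HypH2 (⇑f) (⇑g) h) (H3 : HypH3 h μ)
    (P : ℕ → Set X) (hP : IsPerSelection (⇑f) (⇑g) h P)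
    (ν : Measure X) (hν : WeakClusterPt (fun n => unifMeasure (P n)) ν)
    (η : Measure X) (hηprob : IsProbabilityMeasure η) (hηinv : Measure.map (⇑g) η = η)
    (hsing : η ⟂ₘ ν) :
    mEntropy (⇑g) η < topEntropy (⇑g) := by
  obtain ⟨α₀, hα₀⟩ := hexp
  have hX : Nonempty X := by
    by_contra hne
    rw [not_nonempty_iff] at hne
    have h1 : η univ = 1 := measure_univ
    rw [Set.univ_eq_empty_iff.2 hne, measure_empty] at h1
    exact zero_ne_one h1
  set α := α₀ / 2 with hαdef
  have hα0 : 0 < α := half_pos hα₀.1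
  have hα2 : IsExpansiveWith f (2 * α) := by
    have : 2 * α = α₀ := by rw [hαdef]; ring
    rw [this]; exact hα₀
  have hα : IsExpansiveWith f α :=
    ⟨hα0, fun x y hxy => hα₀.2 x y fun n => (hxy n).trans (half_le_self hα₀.1.le)⟩
  obtain ⟨W, hW, hsup, hS⟩ := SamvaAux.growth hα hspec
  obtain ⟨B, hB⟩ := SamvaAux.rn_le_pow (⇑f) hα0
  obtain ⟨hh, hh0, hup, hlt, hrate⟩ :=
    SamvaAux.rate (SamvaAux.rn f α) W hW (SamvaAux.rn_pos (⇑f) hα0) B hB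
  have htop := SamvaAux.le_topEntropy (f := ⇑f) (g := ⇑g) hcont hsurj hsemi hα0 hW hsup hlt
  have hμinv := SamvaAux.mu_inv hα hμ
  have hlow := SamvaAux.mu_lower hα hμ hW hS hrate
  have hνμ := SamvaAux.nu_map hcont hα hμ hP hν
  have hη' : IsProbabilityMeasure (Measure.map h η) :=
    Measure.isProbabilityMeasure_map hcont.measurable.aemeasurable
  have hη'inv : MeasurePreserving f (Measure.map h η) (Measure.map h η) := by
    refine ⟨f.continuous.measurable, ?_⟩
    rw [Measure.map_map f.continuous.measurable hcont.measurable]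
    have : ⇑f ∘ h = h ∘ ⇑g := funext hsemi
    rw [this, ← Measure.map_map hcont.measurable g.continuous.measurable, hηinv]
  obtain ⟨N, hN, k, β, hβ, hβd, hβH⟩ := SamvaAux.gap hα0 hα2 ⟨f.continuous.measurable, hμinv⟩
    hη'inv hh0 hup hlow
    (fun κ hκ => SamvaAux.small_sets hcont hsurj hνμ H3 hsing hκ)
  have hβ' : SamvaAux.MF (fun x => β (h x)) := fun i => hcont.measurable (hβ i)
  have hH : SamvaAux.Hf η (fun x => β (h x)) = SamvaAux.Hf (Measure.map h η) β := by
    unfold SamvaAux.Hf SamvaAux.pr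
    refine Finset.sum_congr rfl fun i _ => ?_
    rw [map_measureReal_apply hcont.measurable (hβ i)]
    rfl
  have hNr : (0 : ℝ) < N := by exact_mod_cast hN
  have hbound : mEntropy (⇑g) η ≤ ((hh - 1 / (2 * N) : ℝ) : EReal) := by
    refine iSup_le fun Q => ?_
    refine (SamvaAux.main_bound hcont hsurj hsemi hα2 H1 η hηinv hN hβ' hβd Q.2
      (δ := 1 / (6 * N)) (by positivity)).trans ?_
    rw [EReal.coe_le_coe_iff, hH]
    have h1 : SamvaAux.Hf (Measure.map h η) β / N ≤ hh - 1 / N := by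
      rw [div_le_iff₀ hNr]
      have : (hh - 1 / N) * N = N * hh - 1 := by field_simp
      linarith
    have h2 : 3 * (1 / (6 * (N : ℝ))) = 1 / (2 * N) := by field_simp; norm_num
    have h3 : (1 : ℝ) / N = 1 / (2 * N) + 1 / (2 * N) := by field_simp; norm_num
    linarith
  refine lt_of_le_of_lt hbound (lt_of_lt_of_le ?_ htop)
  rw [EReal.coe_lt_coe_iff]
  have : (0 : ℝ) < 1 / (2 * N) := by positivity
  linarith
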